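/- arXiv:0904.2680 — 2 statements merged into one kernel-verified Lean document; each statement's English description precedes it below -/
import Mathlib

section
/- Let X be a standard Brownian motion started at 0, and let f∈C¹(ℝ₊,ℝ) with f(0)≠0, so that the law of T^f has a continuous density p^f with respect to Lebesgue measure. Then for every β∈ℝ and every t<ζ^{(β)}, the density p^{f^{(β)}} of T^{f^{(β)}} satisfies p^{f^{(β)}}(t) = (1+βt)^{-3/2} · exp(-(β/2)·(f^{(β)}(t))²/(1+βt)) · p^f(t/(1+βt)), where f^{(β)}=S^{(β)}(f). -/
open MeasureTheory Filter Set
open scoped ENNReal NNReal Topology Classical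

noncomputable section

/-- Modified Bessel function of the first kind `I_ν`. -/
def besselI (ν x : ℝ) : ℝ :=
  (x / 2) ^ ν * ∑' n : ℕ, (x / 2) ^ (2 * n) / ((n.factorial : ℝ) * Real.Gamma (ν + n + 1))

/-- Bessel function of the first kind `J_ν`. -/
def besselJ (ν x : ℝ) : ℝ :=
  (x / 2) ^ ν *
    ∑' n : ℕ, (-1 : ℝ) ^ n * (x / 2) ^ (2 * n) / ((n.factorial : ℝ) * Real.Gamma (ν + n + 1))

/-- Modified Bessel function of the second kind `K_ν`. -/
def besselK (ν x : ℝ) : ℝ :=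
  ∫ t in Set.Ioi (0 : ℝ), Real.exp (-x * Real.cosh t) * Real.cosh (ν * t)

/-- The reference function `Φ` of the Bessel case. -/
def besselPhi (ν y : ℝ) : ℝ := y ^ (-ν) * besselI ν y

/-- Common form of the transition densities of the diffusions enjoying the time
inversion property: Brownian motion and Bessel processes. -/
def transDensity (c ν : ℝ) (Φ : ℝ → ℝ) (t x y : ℝ) : ℝ :=
  c / Real.sqrt t * Φ (x * y / t) * (y / Real.sqrt t) ^ (2 * ν + 1) *
    Real.exp (-(x ^ 2 + y ^ 2) / (2 * t))

/-- `X` is, under `P`, a conservative diffusion started at `x`, with state space `E`,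
a.s. continuous paths and transition densities `transDensity c ν Φ`, encoded through
its finite dimensional distributions. -/
structure IsTIDiffusion {Ω : Type*} [MeasurableSpace Ω] (E : Set ℝ) (c ν : ℝ) (Φ : ℝ → ℝ)
    (X : ℝ → Ω → ℝ) (P : Measure Ω) (x : ℝ) : Prop where
  isProb : IsProbabilityMeasure P
  meas : ∀ t, Measurable (X t)
  cont : ∀ᵐ ω ∂P, Continuous fun t => X t ω
  mem : ∀ᵐ ω ∂P, ∀ t, 0 ≤ t → X t ω ∈ E
  init : ∀ᵐ ω ∂P, X 0 ω = x
  fdd : ∀ (n : ℕ) (t : Fin (n + 1) → ℝ), StrictMono t → 0 < t 0 →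
    Measure.map (fun ω i => X (t i) ω) P =
      (volume : Measure (Fin (n + 1) → ℝ)).withDensity fun v =>
        ENNReal.ofReal (∏ i : Fin (n + 1),
          transDensity c ν Φ
            ((Fin.cons 0 t : Fin (n + 2) → ℝ) i.succ -
              (Fin.cons 0 t : Fin (n + 2) → ℝ) i.castSucc)
            ((Fin.cons x v : Fin (n + 2) → ℝ) i.castSucc)
            ((Fin.cons x v : Fin (n + 2) → ℝ) i.succ))

/-- Brownian motion on `ℝ`. -/
def IsBrownianMotion {Ω : Type*} [MeasurableSpace Ω] (X : ℝ → Ω → ℝ) (P : Measure Ω)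
    (x : ℝ) : Prop :=
  IsTIDiffusion Set.univ (Real.sqrt (2 * Real.pi))⁻¹ (-(1 : ℝ) / 2) Real.exp X P x

/-- Bessel process of dimension `δ` on `ℝ₊`. -/
def IsBessel {Ω : Type*} [MeasurableSpace Ω] (δ : ℝ) (X : ℝ → Ω → ℝ) (P : Measure Ω)
    (x : ℝ) : Prop :=
  IsTIDiffusion (Set.Ici 0) 1 (δ / 2 - 1) (besselPhi (δ / 2 - 1)) X P x

/-- Parameters of the Brownian case `E = ℝ`. -/
def BrownianParams (E : Set ℝ) (c ν : ℝ) (Φ : ℝ → ℝ) : Prop :=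
  E = Set.univ ∧ c = (Real.sqrt (2 * Real.pi))⁻¹ ∧ ν = -(1 : ℝ) / 2 ∧ Φ = Real.exp

/-- Parameters of the Bessel case `E = ℝ₊`. -/
def BesselParams (E : Set ℝ) (c ν : ℝ) (Φ : ℝ → ℝ) : Prop :=
  ∃ δ : ℝ, 0 < δ ∧ E = Set.Ici 0 ∧ c = 1 ∧ ν = δ / 2 - 1 ∧ Φ = besselPhi (δ / 2 - 1)

/-- The transformation `S^{(β)}` on functions. -/
def Sb (β : ℝ) (f : ℝ → ℝ) : ℝ → ℝ := fun t => (1 + β * t) * f (t / (1 + β * t))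

/-- First crossing time `T^f = inf {s > 0 : X_s = f(s)}` (with `inf ∅ = ∞`). -/
def hitTime {Ω : Type*} (X : ℝ → Ω → ℝ) (f : ℝ → ℝ) (ω : Ω) : ℝ≥0∞ :=
  ⨅ s ∈ {s : ℝ | 0 < s ∧ X s ω = f s}, ENNReal.ofReal s

/-- First crossing time of a curve which is only defined on `[0, ζ^{(β)})`. -/
def hitTimeUntil {Ω : Type*} (X : ℝ → Ω → ℝ) (β : ℝ) (f : ℝ → ℝ) (ω : Ω) : ℝ≥0∞ :=
  ⨅ s ∈ {s : ℝ | 0 < s ∧ 0 < 1 + β * s ∧ X s ω = f s}, ENNReal.ofReal s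

/-- `p` is a density on `(0,∞)` of the (possibly defective) law of the random time `T`
under `P`. -/
def HasHitDensity {Ω : Type*} [MeasurableSpace Ω] (T : Ω → ℝ≥0∞) (P : Measure Ω)
    (p : ℝ → ℝ) : Prop :=
  ∀ s : Set ℝ, MeasurableSet s → s ⊆ Set.Ioi 0 →
    P (T ⁻¹' (ENNReal.ofReal '' s)) = ∫⁻ t in s, ENNReal.ofReal (p t) ∂volume

/-- Natural sigma-algebra of the process `X` at time `t`. -/
def natSigma {Ω : Type*} (X : ℝ → Ω → ℝ) (t : ℝ) : MeasurableSpace Ω :=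
  ⨆ s ∈ Set.Icc (0 : ℝ) t, MeasurableSpace.comap (X s) Real.measurableSpace

/-- `Py = ℙ_x^{(y)}` is the `Φ(y·)`-transform of `P = ℙ_x`:
`dℙ_x^{(y)}|_{F_t} = (Φ(yX_t)/Φ(yx)) e^{-y²t/2} dℙ_x|_{F_t}`. -/
def IsHTransform {Ω : Type*} [MeasurableSpace Ω] (X : ℝ → Ω → ℝ) (P Py : Measure Ω)
    (Φ : ℝ → ℝ) (x y : ℝ) : Prop :=
  ∀ t : ℝ, 0 < t → ∀ A : Set Ω, MeasurableSet[natSigma X t] A →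
    Py A = ∫⁻ ω in A,
      ENNReal.ofReal (Φ (y * X t ω) / Φ (y * x) * Real.exp (-y ^ 2 * t / 2)) ∂P


/-- The path transformation `(S^{(β)} X)_t + θ t`. -/
def tiltProc {Ω : Type*} (β θ : ℝ) (X : ℝ → Ω → ℝ) (t : ℝ) (ω : Ω) : ℝ :=
  (1 + β * t) * X (t / (1 + β * t)) ω + θ * t

/-- The density at time `t` of the law of `tiltProc β θ X` with respect to the law of the
Brownian motion `X`, as a function of the position at time `t`. -/
def tiltWeight (β θ t x : ℝ) : ℝ :=
  (Real.sqrt (1 + β * t))⁻¹ *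
    Real.exp ((β * x ^ 2 + 2 * θ * x - θ ^ 2 * t) / (2 * (1 + β * t)))

lemma tiltWeight_pos {β θ t x : ℝ} (h : 0 < 1 + β * t) : 0 < tiltWeight β θ t x := by
  unfold tiltWeight
  positivity

lemma measurable_tiltWeight (β θ t : ℝ) : Measurable (tiltWeight β θ t) := by
  unfold tiltWeight
  fun_prop

lemma transDensity_tilt (c β θ : ℝ) {s t : ℝ} (hst : s < t) (hs : 0 < 1 + β * s)
    (ht : 0 < 1 + β * t) (u v : ℝ) :
    transDensity c (-(1 : ℝ) / 2) Real.exp (t / (1 + β * t) - s / (1 + β * s))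
        ((u - θ * s) / (1 + β * s)) ((v - θ * t) / (1 + β * t)) * (1 + β * t)⁻¹ =
      transDensity c (-(1 : ℝ) / 2) Real.exp (t - s) u v *
        (tiltWeight β θ t v / tiltWeight β θ s u) := by
  have hd : 0 < t - s := sub_pos.2 hst
  have e0 : (2 * (-(1 : ℝ) / 2) + 1) = 0 := by norm_num
  have e1 : t / (1 + β * t) - s / (1 + β * s) = (t - s) / ((1 + β * s) * (1 + β * t)) := by
    rw [div_sub_div _ _ ht.ne' hs.ne']
    congr 1 <;> ring
  unfold transDensity tiltWeight
  rw [e0, Real.rpow_zero, Real.rpow_zero, e1, Real.sqrt_div hd.le, Real.sqrt_mul hs.le]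
  generalize hA : 1 + β * s = A at *
  generalize hB : 1 + β * t = B at *
  have hsA : 0 < √A := Real.sqrt_pos.2 hs
  have hsB : 0 < √B := Real.sqrt_pos.2 ht
  have hsd : 0 < √(t - s) := Real.sqrt_pos.2 hd
  have key : Real.exp ((u - θ * s) / A * ((v - θ * t) / B) / ((t - s) / (A * B))) *
      Real.exp (-(((u - θ * s) / A) ^ 2 + ((v - θ * t) / B) ^ 2) / (2 * ((t - s) / (A * B)))) *
      Real.exp ((β * u ^ 2 + 2 * θ * u - θ ^ 2 * s) / (2 * A)) =
      Real.exp (u * v / (t - s)) * Real.exp (-(u ^ 2 + v ^ 2) / (2 * (t - s))) *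
      Real.exp ((β * v ^ 2 + 2 * θ * v - θ ^ 2 * t) / (2 * B)) := by
    rw [← Real.exp_add, ← Real.exp_add, ← Real.exp_add, ← Real.exp_add]
    congr 1
    have := hs.ne'
    have := ht.ne'
    have := hd.ne'
    field_simp
    subst hA hB
    ring
  have hE := Real.exp_pos ((β * u ^ 2 + 2 * θ * u - θ ^ 2 * s) / (2 * A))
  have hBB : B = √B * √B := (Real.mul_self_sqrt ht.le).symm
  generalize Real.exp ((β * u ^ 2 + 2 * θ * u - θ ^ 2 * s) / (2 * A)) = E1 at *
  generalize Real.exp ((β * v ^ 2 + 2 * θ * v - θ ^ 2 * t) / (2 * B)) = E2 at *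
  generalize Real.exp ((u - θ * s) / A * ((v - θ * t) / B) / ((t - s) / (A * B))) = E3 at *
  generalize Real.exp (-(((u - θ * s) / A) ^ 2 + ((v - θ * t) / B) ^ 2) /
    (2 * ((t - s) / (A * B)))) = E4 at *
  generalize Real.exp (u * v / (t - s)) = E5 at *
  generalize Real.exp (-(u ^ 2 + v ^ 2) / (2 * (t - s))) = E6 at *
  have : E3 * E4 = E5 * E6 * E2 / E1 := by
    rw [eq_div_iff hE.ne', key]
  have h1 : c / (√(t - s) / (√A * √B)) * E3 * 1 * E4 * B⁻¹ =
    c * √A * √B / √(t - s) * B⁻¹ * (E3 * E4) := by field_simp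
  rw [h1, this]
  nth_rewrite 2 [hBB]
  field_simp

lemma prod_succ_div_castSucc {n : ℕ} (F : Fin (n + 1) → ℝ) (hF : ∀ i, F i ≠ 0) :
    ∏ i : Fin n, F i.succ / F i.castSucc = F (Fin.last n) / F 0 := by
  induction n with
  | zero => simp [div_self (hF 0)]
  | succ n ih =>
    rw [Fin.prod_univ_castSucc]
    have := ih (fun i => F i.castSucc) (fun i => hF _)
    simp only [Fin.succ_castSucc] at this ⊢
    rw [this]
    have h1 := hF (Fin.last n).castSucc
    have h0 := hF 0
    simp only [Fin.succ_last, Fin.castSucc_zero]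
    field_simp

/-- Joint density of the positions of Brownian motion at the times `t i`. -/
def bmDensity {n : ℕ} (t v : Fin (n + 1) → ℝ) : ℝ :=
  ∏ i : Fin (n + 1),
    transDensity (Real.sqrt (2 * Real.pi))⁻¹ (-(1 : ℝ) / 2) Real.exp
      ((Fin.cons 0 t : Fin (n + 2) → ℝ) i.succ - (Fin.cons 0 t : Fin (n + 2) → ℝ) i.castSucc)
      ((Fin.cons 0 v : Fin (n + 2) → ℝ) i.castSucc) ((Fin.cons 0 v : Fin (n + 2) → ℝ) i.succ)

lemma measurable_bmDensity {n : ℕ} (t : Fin (n + 1) → ℝ) : Measurable (bmDensity t) := by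
  have h : ∀ j : Fin (n + 2),
      Measurable fun v : Fin (n + 1) → ℝ => (Fin.cons 0 v : Fin (n + 2) → ℝ) j := by
    intro j
    refine Fin.cases ?_ (fun i => ?_) j
    · simp
    · simpa using measurable_pi_apply i
  unfold bmDensity transDensity
  refine Finset.measurable_prod _ fun i _ => ?_
  have h1 := h i.castSucc
  have h2 := h i.succ
  have e0 : (2 * (-(1 : ℝ) / 2) + 1) = 0 := by norm_num
  simp only [e0, Real.rpow_zero]
  fun_prop

lemma pos_of_le {β s t : ℝ} (hs : 0 ≤ s) (hst : s ≤ t) (ht : 0 < 1 + β * t) :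
    0 < 1 + β * s := by
  rcases le_total 0 β with h | h
  · nlinarith [mul_nonneg h hs]
  · nlinarith [mul_le_mul_of_nonpos_left hst h]

lemma cons_nonneg {n : ℕ} {t : Fin (n + 1) → ℝ} (hmono : StrictMono t) (h0 : 0 < t 0)
    (j : Fin (n + 2)) : 0 ≤ (Fin.cons 0 t : Fin (n + 2) → ℝ) j := by
  refine Fin.cases (by simp) (fun i => ?_) j
  simpa using h0.le.trans (hmono.monotone (Fin.zero_le i))

lemma cons_le_last {n : ℕ} {t : Fin (n + 1) → ℝ} (hmono : StrictMono t) (h0 : 0 < t 0)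
    (j : Fin (n + 2)) : (Fin.cons 0 t : Fin (n + 2) → ℝ) j ≤ t (Fin.last n) := by
  refine Fin.cases ?_ (fun i => ?_) j
  · simpa using h0.le.trans (hmono.monotone (Fin.zero_le _))
  · simpa using hmono.monotone (Fin.le_last i)

lemma cons_lt {n : ℕ} {t : Fin (n + 1) → ℝ} (hmono : StrictMono t) (h0 : 0 < t 0)
    (i : Fin (n + 1)) :
    (Fin.cons 0 t : Fin (n + 2) → ℝ) i.castSucc < (Fin.cons 0 t : Fin (n + 2) → ℝ) i.succ := by
  refine Fin.cases ?_ (fun k => ?_) i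
  · simpa using h0
  · rw [← Fin.succ_castSucc]
    simpa using hmono Fin.castSucc_lt_succ

lemma bmDensity_tilt (β θ : ℝ) {n : ℕ} {t : Fin (n + 1) → ℝ} (hmono : StrictMono t)
    (h0 : 0 < t 0) (hlast : 0 < 1 + β * t (Fin.last n)) (v : Fin (n + 1) → ℝ) :
    bmDensity (fun i => t i / (1 + β * t i)) (fun i => (v i - θ * t i) / (1 + β * t i)) *
        ∏ i, (1 + β * t i)⁻¹ =
      bmDensity t v * tiltWeight β θ (t (Fin.last n)) (v (Fin.last n)) := by
  set T : Fin (n + 2) → ℝ := Fin.cons 0 t with hT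
  set V : Fin (n + 2) → ℝ := Fin.cons 0 v with hV
  have hpos : ∀ j, 0 < 1 + β * T j := fun j =>
    pos_of_le (cons_nonneg hmono h0 j) (cons_le_last hmono h0 j) hlast
  have eT : (Fin.cons 0 (fun i => t i / (1 + β * t i)) : Fin (n + 2) → ℝ) =
      fun j => T j / (1 + β * T j) := by
    funext j
    refine Fin.cases ?_ (fun i => ?_) j <;> simp [hT]
  have eV : (Fin.cons 0 (fun i => (v i - θ * t i) / (1 + β * t i)) : Fin (n + 2) → ℝ) =
      fun j => (V j - θ * T j) / (1 + β * T j) := by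
    funext j
    refine Fin.cases ?_ (fun i => ?_) j <;> simp [hT, hV]
  have e1 : ∀ i, (1 + β * t i)⁻¹ = (1 + β * T i.succ)⁻¹ := fun i => by simp [hT]
  unfold bmDensity
  rw [eT, eV, Finset.prod_congr rfl fun i _ => e1 i, ← Finset.prod_mul_distrib]
  rw [Finset.prod_congr rfl fun i _ => transDensity_tilt _ β θ (cons_lt hmono h0 i)
    (hpos i.castSucc) (hpos i.succ) (V i.castSucc) (V i.succ)]
  rw [Finset.prod_mul_distrib, prod_succ_div_castSucc
    (fun j => tiltWeight β θ (T j) (V j)) (fun j => (tiltWeight_pos (hpos j)).ne')]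
  congr 1
  rw [← Fin.succ_last]
  simp [hT, hV, tiltWeight]

lemma map_withDensity_comp {α γ : Type*} [MeasurableSpace α] [MeasurableSpace γ]
    (μ : Measure α) {φ : α → γ} (hφ : Measurable φ) {G : γ → ℝ≥0∞} (hG : Measurable G) :
    (μ.withDensity fun a => G (φ a)).map φ = (μ.map φ).withDensity G := by
  ext B hB
  rw [Measure.map_apply hφ hB, withDensity_apply _ (hφ hB), withDensity_apply _ hB,
    setLIntegral_map hB hG hφ]

lemma volume_eq_smul_map_affine {ι : Type*} [Fintype ι] (A C : ι → ℝ) (hA : ∀ i, 0 < A i) :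
    (volume : Measure (ι → ℝ)) =
      ENNReal.ofReal (∏ i, A i) • Measure.map (fun (v : ι → ℝ) i => A i * v i + C i) volume := by
  have hm : Measurable fun (v : ι → ℝ) i => A i * v i + C i := by fun_prop
  refine Measure.pi_eq fun s hs => ?_
  rw [Measure.smul_apply, Measure.map_apply hm (MeasurableSet.univ_pi hs)]
  have hpre : (fun (v : ι → ℝ) i => A i * v i + C i) ⁻¹' Set.pi Set.univ s =
      Set.pi Set.univ fun i => (fun x => A i * x) ⁻¹' ((fun x => x + C i) ⁻¹' s i) := by
    ext v
    simp [Set.mem_pi]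
  rw [hpre, volume_pi_pi, ENNReal.ofReal_prod_of_nonneg fun i _ => (hA i).le, smul_eq_mul,
    ← Finset.prod_mul_distrib]
  refine Finset.prod_congr rfl fun i _ => ?_
  rw [Real.volume_preimage_mul_left (hA i).ne', measure_preimage_add_right, ← mul_assoc,
    ← ENNReal.ofReal_mul (hA i).le, abs_of_pos (inv_pos.2 (hA i)),
    mul_inv_cancel₀ (hA i).ne', ENNReal.ofReal_one, one_mul]

/-- The measure under which the Brownian motion `X` has, up to time `b`, the law that
`tiltProc β θ X` has under `P`. -/
def tiltMeasure {Ω : Type*} [MeasurableSpace Ω] (P : Measure Ω) (X : ℝ → Ω → ℝ)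
    (β θ b : ℝ) : Measure Ω :=
  P.withDensity fun ω => ENNReal.ofReal (tiltWeight β θ b (X b ω))

section Brownian

variable {Ω : Type*} [MeasurableSpace Ω] {X : ℝ → Ω → ℝ} {P : Measure Ω}

lemma measurable_tiltProc (hX : IsBrownianMotion X P 0) (β θ t : ℝ) :
    Measurable (tiltProc β θ X t) := by
  unfold tiltProc
  have := hX.meas (t / (1 + β * t))
  fun_prop

lemma div_lt_div_tilt {β s t : ℝ} (hst : s < t) (hs : 0 < 1 + β * s) (ht : 0 < 1 + β * t) :
    s / (1 + β * s) < t / (1 + β * t) := by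
  rw [div_lt_div_iff₀ hs ht]
  nlinarith

set_option maxHeartbeats 800000 in
lemma map_tiltProc_fin (hX : IsBrownianMotion X P 0) (β θ : ℝ) {n : ℕ} {t : Fin (n + 1) → ℝ}
    (hmono : StrictMono t) (h0 : 0 < t 0) (hlast : 0 < 1 + β * t (Fin.last n)) :
    P.map (fun ω i => tiltProc β θ X (t i) ω) =
      (tiltMeasure P X β θ (t (Fin.last n))).map fun ω i => X (t i) ω := by
  have hpos : ∀ i, 0 < 1 + β * t i := fun i =>
    pos_of_le (h0.le.trans (hmono.monotone (Fin.zero_le i))) (hmono.monotone (Fin.le_last i)) hlast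
  have hXm : ∀ r : Fin (n + 1) → ℝ, Measurable fun ω i => X (r i) ω := fun r =>
    measurable_pi_lambda _ fun i => hX.meas _
  set L : (Fin (n + 1) → ℝ) → Fin (n + 1) → ℝ := fun v i => (1 + β * t i) * v i + θ * t i with hL
  have hLm : Measurable L := by fun_prop
  have hW : Measurable fun w : Fin (n + 1) → ℝ =>
      ENNReal.ofReal (tiltWeight β θ (t (Fin.last n)) (w (Fin.last n))) :=
    ((measurable_tiltWeight _ _ _).comp (measurable_pi_apply _)).ennreal_ofReal
  have hσ : StrictMono fun i => t i / (1 + β * t i) := fun i j hij =>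
    div_lt_div_tilt (hmono hij) (hpos i) (hpos j)
  have e1 := hX.fdd n (fun i => t i / (1 + β * t i)) hσ (div_pos h0 (hpos 0))
  have e2 := hX.fdd n t hmono h0
  have eR : (tiltMeasure P X β θ (t (Fin.last n))).map (fun ω i => X (t i) ω) =
      (P.map fun ω i => X (t i) ω).withDensity fun w =>
        ENNReal.ofReal (tiltWeight β θ (t (Fin.last n)) (w (Fin.last n))) :=
    map_withDensity_comp P (hXm t) hW
  have eL : P.map (fun ω i => tiltProc β θ X (t i) ω) =
      (P.map fun ω i => X (t i / (1 + β * t i)) ω).map L := by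
    rw [Measure.map_map hLm (hXm _)]
    rfl
  rw [eL, eR, e1, e2]
  change ((volume : Measure (Fin (n + 1) → ℝ)).withDensity fun v =>
      ENNReal.ofReal (bmDensity (fun i => t i / (1 + β * t i)) v)).map L =
    ((volume : Measure (Fin (n + 1) → ℝ)).withDensity fun v =>
      ENNReal.ofReal (bmDensity t v)).withDensity _
  rw [← withDensity_mul _ (measurable_bmDensity t).ennreal_ofReal hW]
  set K : (Fin (n + 1) → ℝ) → Fin (n + 1) → ℝ := fun w i =>
    (w i - θ * t i) / (1 + β * t i) with hK
  have hKm : Measurable K := by fun_prop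
  have hKL : ∀ v, K (L v) = v := by
    intro v
    funext i
    have := (hpos i).ne'
    simp only [hK, hL]
    field_simp
    ring
  have hden : (fun v => ENNReal.ofReal (bmDensity (fun i => t i / (1 + β * t i)) v)) =
      fun v => ENNReal.ofReal (bmDensity (fun i => t i / (1 + β * t i)) (K (L v))) := by
    simp_rw [hKL]
  have hDm : Measurable fun w => bmDensity (fun i => t i / (1 + β * t i)) (K w) :=
    (measurable_bmDensity fun i => t i / (1 + β * t i)).comp hKm
  rw [hden, map_withDensity_comp volume hLm hDm.ennreal_ofReal]
  conv_rhs => rw [volume_eq_smul_map_affine (fun i => 1 + β * t i) (fun i => θ * t i) hpos]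
  rw [withDensity_smul_measure, ← withDensity_smul _
    ((measurable_bmDensity t).ennreal_ofReal.mul hW)]
  congr 1
  funext w
  have hprod : (∏ i, (1 + β * t i)) * ∏ i, (1 + β * t i)⁻¹ = 1 := by
    rw [← Finset.prod_mul_distrib]
    exact Finset.prod_eq_one fun i _ => mul_inv_cancel₀ (hpos i).ne'
  have hD : bmDensity (fun i => t i / (1 + β * t i)) (K w) =
      (∏ i, (1 + β * t i)) *
        (bmDensity t w * tiltWeight β θ (t (Fin.last n)) (w (Fin.last n))) := by
    rw [← bmDensity_tilt β θ hmono h0 hlast w, mul_left_comm, hprod, mul_one]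
  simp only [Pi.smul_apply, Pi.mul_apply, smul_eq_mul]
  rw [← ENNReal.ofReal_mul' (tiltWeight_pos hlast).le, hD,
    ENNReal.ofReal_mul (Finset.prod_nonneg fun i _ => (hpos i).le)]

lemma map_tiltProc_path (hX : IsBrownianMotion X P 0) (β θ : ℝ) {b : ℝ} (hb : 0 < b)
    (hβb : 0 < 1 + β * b) :
    P.map (fun ω (s : Set.Ioc 0 b) => tiltProc β θ X s ω) =
      (tiltMeasure P X β θ b).map fun ω (s : Set.Ioc 0 b) => X s ω := by
  have := hX.isProb
  have hYm : Measurable fun ω (s : Set.Ioc 0 b) => tiltProc β θ X s ω :=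
    measurable_pi_lambda _ fun s => measurable_tiltProc hX β θ s
  have hXm : Measurable fun ω (s : Set.Ioc 0 b) => X s ω :=
    measurable_pi_lambda _ fun s => hX.meas s
  have := Measure.isProbabilityMeasure_map (μ := P) hYm.aemeasurable
  refine IsProjectiveLimit.unique (P := fun I : Finset (Set.Ioc 0 b) =>
    (P.map (fun ω (s : Set.Ioc 0 b) => tiltProc β θ X s ω)).map I.restrict)
    (fun I => rfl) fun I => ?_
  set b' : Set.Ioc 0 b := ⟨b, hb, le_rfl⟩
  obtain ⟨n, hn⟩ : ∃ n, (insert b' I).card = n + 1 :=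
    Nat.exists_eq_succ_of_ne_zero (Finset.card_pos.2 (Finset.insert_nonempty _ _)).ne'
  set e := (insert b' I).orderEmbOfFin hn
  have hrange : ∀ j ∈ insert b' I, ∃ i, e i = j := fun j hj => by
    have := Finset.range_orderEmbOfFin (insert b' I) hn
    have hj' : j ∈ Set.range e := by rw [this]; exact hj
    exact hj'
  have hlast : ((e (Fin.last n) : Set.Ioc 0 b) : ℝ) = b := by
    obtain ⟨i, hi⟩ := hrange b' (Finset.mem_insert_self _ _)
    have h1 : e i ≤ e (Fin.last n) := e.monotone (Fin.le_last i)
    rw [hi] at h1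
    exact le_antisymm (e (Fin.last n)).2.2 h1
  choose idx hidx using fun j : I => hrange j (Finset.mem_insert_of_mem j.2)
  have key := map_tiltProc_fin hX β θ (t := fun i => (e i : ℝ))
    (fun i j hij => e.strictMono hij) (e 0).2.1 (by rw [hlast]; exact hβb)
  rw [hlast] at key
  have hΨ : Measurable fun (v : Fin (n + 1) → ℝ) (j : I) => v (idx j) := by fun_prop
  have hR : Measurable (I.restrict : (Set.Ioc 0 b → ℝ) → I → ℝ) := Finset.measurable_restrict I
  have key2 := congrArg (Measure.map fun (v : Fin (n + 1) → ℝ) (j : I) => v (idx j)) key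
  rw [Measure.map_map hΨ (measurable_pi_lambda _ fun i => measurable_tiltProc hX β θ _),
    Measure.map_map hΨ (measurable_pi_lambda _ fun i => hX.meas _)] at key2
  dsimp only
  rw [Measure.map_map hR hXm, Measure.map_map hR hYm]
  have e1 : (I.restrict : (Set.Ioc 0 b → ℝ) → I → ℝ) ∘
      (fun ω (s : Set.Ioc 0 b) => tiltProc β θ X s ω) =
      (fun (v : Fin (n + 1) → ℝ) (j : I) => v (idx j)) ∘
        fun ω i => tiltProc β θ X (e i) ω := by
    funext ω j
    simp [hidx]
  have e2 : (I.restrict : (Set.Ioc 0 b → ℝ) → I → ℝ) ∘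
      (fun ω (s : Set.Ioc 0 b) => X s ω) =
      (fun (v : Fin (n + 1) → ℝ) (j : I) => v (idx j)) ∘ fun ω i => X (e i) ω := by
    funext ω j
    simp [hidx]
  rw [e1, e2, key2]

/-- The event that the process `Z` avoids the curve `g` on `[0, a]`. -/
def avoidSet {Ω : Type*} (Z : ℝ → Ω → ℝ) (g : ℝ → ℝ) (a : ℝ) : Set Ω :=
  {ω | ∀ s ∈ Set.Icc 0 a, Z s ω ≠ g s}

/-- The paths, restricted to `(0, b]`, which stay away from `g` along the sequence `q`. -/
def avoidPaths {b : ℝ} (g : ℝ → ℝ) (q : ℕ → Set.Ioc 0 b) : Set (Set.Ioc 0 b → ℝ) :=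
  {w | ∃ k : ℕ, ∀ j, 1 / ((k : ℝ) + 1) ≤ |w (q j) - g (q j)|}

lemma measurableSet_avoidPaths {b : ℝ} (g : ℝ → ℝ) (q : ℕ → Set.Ioc 0 b) :
    MeasurableSet (avoidPaths g q) := by
  have : avoidPaths g q = ⋃ k : ℕ, ⋂ j, {w | 1 / ((k : ℝ) + 1) ≤ |w (q j) - g (q j)|} := by
    ext w
    simp [avoidPaths]
  rw [this]
  refine MeasurableSet.iUnion fun k => MeasurableSet.iInter fun j => ?_
  refine measurableSet_le measurable_const ?_
  have : Measurable fun w : Set.Ioc 0 b → ℝ => w (q j) := measurable_pi_apply _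
  simpa [Real.norm_eq_abs] using (this.sub_const (g (q j))).norm

lemma forall_ne_iff_of_dense {a : ℝ} (ha : 0 < a) {z g : ℝ → ℝ}
    (hz : ContinuousOn z (Set.Icc 0 a)) (hg : ContinuousOn g (Set.Icc 0 a))
    {q : ℕ → Set.Ioc 0 a} (hq : DenseRange q) :
    (∀ s ∈ Set.Icc 0 a, z s ≠ g s) ↔ ∃ k : ℕ, ∀ j, 1 / ((k : ℝ) + 1) ≤ |z (q j) - g (q j)| := by
  have hc : ContinuousOn (fun s => |z s - g s|) (Set.Icc 0 a) := (hz.sub hg).abs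
  constructor
  · intro h
    obtain ⟨s, hs, hmin⟩ := isCompact_Icc.exists_isMinOn (Set.nonempty_Icc.2 ha.le) hc
    obtain ⟨k, hk⟩ := exists_nat_one_div_lt (abs_pos.2 (sub_ne_zero.2 (h s hs)))
    exact ⟨k, fun j => hk.le.trans (hmin (Set.Ioc_subset_Icc_self (q j).2))⟩
  · rintro ⟨k, hk⟩ s hs
    have h1 : ∀ x : Set.Ioc 0 a, 1 / ((k : ℝ) + 1) ≤ |z x - g x| := fun x => by
      refine hq.induction_on (p := fun x : Set.Ioc 0 a => 1 / ((k : ℝ) + 1) ≤ |z x - g x|) x ?_ hk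
      refine isClosed_le continuous_const ?_
      exact (hc.mono Set.Ioc_subset_Icc_self).domRestrict
    have h2 : 1 / ((k : ℝ) + 1) ≤ |z s - g s| := by
      have hcl : closure (Set.Ioc 0 a) = Set.Icc 0 a := closure_Ioc ha.ne
      refine le_on_closure (s := Set.Ioc 0 a) (f := fun _ => 1 / ((k : ℝ) + 1))
        (g := fun s => |z s - g s|) (fun x hx => h1 ⟨x, hx⟩) continuousOn_const
        (by rwa [hcl]) (by rwa [hcl])
    have : (0 : ℝ) < 1 / ((k : ℝ) + 1) := by positivity
    exact sub_ne_zero.1 (abs_pos.1 (this.trans_le h2))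

lemma exists_avoidPaths {Ω : Type*} {a b : ℝ} (ha : 0 < a) (hab : a ≤ b) {g : ℝ → ℝ}
    (hg : ContinuousOn g (Set.Icc 0 a)) :
    ∃ W : Set (Set.Ioc 0 b → ℝ), MeasurableSet W ∧
      ∀ Z : ℝ → Ω → ℝ, ∀ ω, ContinuousOn (fun s => Z s ω) (Set.Icc 0 a) →
        (ω ∈ avoidSet Z g a ↔ (fun s : Set.Ioc 0 b => Z s ω) ∈ W) := by
  have : Nonempty (Set.Ioc 0 a) := ⟨⟨a, ha, le_rfl⟩⟩
  set q := TopologicalSpace.denseSeq (Set.Ioc 0 a)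
  refine ⟨avoidPaths g fun j => Set.inclusion (Set.Ioc_subset_Ioc_right hab) (q j),
    measurableSet_avoidPaths _ _, fun Z ω hZ => ?_⟩
  exact forall_ne_iff_of_dense ha hZ hg (TopologicalSpace.denseRange_denseSeq _)

lemma ae_continuousOn_tiltProc (hX : IsBrownianMotion X P 0) (β θ : ℝ) {a : ℝ}
    (hβa : 0 < 1 + β * a) :
    ∀ᵐ ω ∂P, ContinuousOn (fun s => tiltProc β θ X s ω) (Set.Icc 0 a) := by
  filter_upwards [hX.cont] with ω hω
  have h1 : ContinuousOn (fun s : ℝ => s / (1 + β * s)) (Set.Icc 0 a) :=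
    continuousOn_id.div (by fun_prop) fun s hs => (pos_of_le hs.1 hs.2 hβa).ne'
  have h2 : ContinuousOn (fun s => X (s / (1 + β * s)) ω) (Set.Icc 0 a) :=
    hω.comp_continuousOn h1
  unfold tiltProc
  fun_prop

lemma measure_avoidSet_tiltProc (hX : IsBrownianMotion X P 0) (β θ : ℝ) {a b : ℝ} (ha : 0 < a)
    (hab : a ≤ b) (hβb : 0 < 1 + β * b) {g : ℝ → ℝ} (hg : ContinuousOn g (Set.Icc 0 a)) :
    P (avoidSet (tiltProc β θ X) g a) = tiltMeasure P X β θ b (avoidSet X g a) := by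
  obtain ⟨W, hW, hWZ⟩ := exists_avoidPaths (Ω := Ω) ha hab hg
  have hYm : Measurable fun ω (s : Set.Ioc 0 b) => tiltProc β θ X s ω :=
    measurable_pi_lambda _ fun s => measurable_tiltProc hX β θ s
  have hXm : Measurable fun ω (s : Set.Ioc 0 b) => X s ω :=
    measurable_pi_lambda _ fun s => hX.meas s
  have hac : tiltMeasure P X β θ b ≪ P := withDensity_absolutelyContinuous _ _
  have e1 : avoidSet (tiltProc β θ X) g a =ᵐ[P]
      (fun ω (s : Set.Ioc 0 b) => tiltProc β θ X s ω) ⁻¹' W := by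
    filter_upwards [ae_continuousOn_tiltProc hX β θ (pos_of_le ha.le hab hβb)] with ω hω
    exact propext (hWZ _ ω hω)
  have e2 : avoidSet X g a =ᵐ[tiltMeasure P X β θ b]
      (fun ω (s : Set.Ioc 0 b) => X s ω) ⁻¹' W := by
    filter_upwards [hac.ae_le hX.cont] with ω hω
    exact propext (hWZ _ ω hω.continuousOn)
  rw [measure_congr e1, measure_congr e2, ← Measure.map_apply hYm hW, ← Measure.map_apply hXm hW,
    map_tiltProc_path hX β θ (ha.trans_le hab) hβb]

lemma nullMeasurableSet_avoidSet (hX : IsBrownianMotion X P 0) {a : ℝ} (ha : 0 < a) {g : ℝ → ℝ}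
    (hg : ContinuousOn g (Set.Icc 0 a)) : NullMeasurableSet (avoidSet X g a) P := by
  obtain ⟨W, hW, hWZ⟩ := exists_avoidPaths (Ω := Ω) ha le_rfl hg
  have hXm : Measurable fun ω (s : Set.Ioc 0 a) => X s ω :=
    measurable_pi_lambda _ fun s => hX.meas s
  refine (hXm hW).nullMeasurableSet.congr ?_
  filter_upwards [hX.cont] with ω hω
  exact propext (hWZ _ ω hω.continuousOn).symm

lemma avoidSet_anti {Ω : Type*} (Z : ℝ → Ω → ℝ) (g : ℝ → ℝ) {a b : ℝ} (hab : a ≤ b) :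
    avoidSet Z g b ⊆ avoidSet Z g a := fun _ h s hs => h s ⟨hs.1, hs.2.trans hab⟩

lemma tiltMeasure_univ (hX : IsBrownianMotion X P 0) (β θ : ℝ) {b : ℝ} (hb : 0 < b)
    (hβb : 0 < 1 + β * b) : tiltMeasure P X β θ b Set.univ = 1 := by
  have := hX.isProb
  have h := congrArg (fun μ => μ Set.univ) (map_tiltProc_path hX β θ hb hβb)
  have hYm : Measurable fun ω (s : Set.Ioc 0 b) => tiltProc β θ X s ω :=
    measurable_pi_lambda _ fun s => measurable_tiltProc hX β θ s
  have hXm : Measurable fun ω (s : Set.Ioc 0 b) => X s ω :=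
    measurable_pi_lambda _ fun s => hX.meas s
  rw [Measure.map_apply hYm .univ, Measure.map_apply hXm .univ] at h
  simpa using h.symm

lemma avoidSet_tiltProc_zero {Ω : Type*} {X : ℝ → Ω → ℝ} {β : ℝ} {a : ℝ}
    (hβa : 0 < 1 + β * a) {f g : ℝ → ℝ}
    (hfg : ∀ s ∈ Set.Icc 0 a, g s = (1 + β * s) * f (s / (1 + β * s))) :
    avoidSet (tiltProc β 0 X) g a = avoidSet X f (a / (1 + β * a)) := by
  ext ω
  constructor
  · intro h r hr
    have hr1 : r * (1 + β * a) ≤ a := (le_div_iff₀ hβa).1 hr.2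
    have hpos : 0 < 1 - β * r := by
      by_contra hcon
      push Not at hcon
      have ha : 0 ≤ a := (mul_nonneg hr.1 hβa.le).trans hr1
      have hr0 : r = 0 := le_antisymm (by nlinarith [mul_nonneg ha (neg_nonneg.2 hcon)]) hr.1
      rw [hr0] at hcon
      linarith
    have hs : r / (1 - β * r) ∈ Set.Icc 0 a := by
      refine ⟨div_nonneg hr.1 hpos.le, ?_⟩
      rw [div_le_iff₀ hpos]
      nlinarith
    have h1 : 0 < 1 + β * (r / (1 - β * r)) := pos_of_le hs.1 hs.2 hβa
    have e : r / (1 - β * r) / (1 + β * (r / (1 - β * r))) = r := by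
      have h2 : 1 + β * (r / (1 - β * r)) = 1 / (1 - β * r) := by
        field_simp
        ring
      rw [h2, one_div, div_inv_eq_mul, div_mul_cancel₀ _ hpos.ne']
    have := h _ hs
    rw [hfg _ hs, tiltProc, e] at this
    intro hcon
    apply this
    rw [hcon]
    ring
  · intro h s hs
    have h1 : 0 < 1 + β * s := pos_of_le hs.1 hs.2 hβa
    have hr : s / (1 + β * s) ∈ Set.Icc 0 (a / (1 + β * a)) := by
      refine ⟨div_nonneg hs.1 h1.le, ?_⟩
      rw [div_le_div_iff₀ h1 hβa]
      nlinarith [hs.2]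
    rw [hfg s hs, tiltProc]
    intro hcon
    refine h _ hr (mul_left_cancel₀ h1.ne' ?_)
    linarith

/-- Change of measure for the event that the first crossing takes place in `(a, b]`. -/
lemma measure_avoidSet_diff_tilt (hX : IsBrownianMotion X P 0) {β : ℝ} {a b : ℝ} (ha : 0 < a)
    (hab : a ≤ b) (hβb : 0 < 1 + β * b) {f g : ℝ → ℝ} (hg : ContinuousOn g (Set.Icc 0 b))
    (hf : ContinuousOn f (Set.Icc 0 (b / (1 + β * b))))
    (hfg : ∀ s ∈ Set.Icc 0 b, g s = (1 + β * s) * f (s / (1 + β * s))) :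
    P (avoidSet X f (a / (1 + β * a)) \ avoidSet X f (b / (1 + β * b))) =
      tiltMeasure P X β 0 b (avoidSet X g a \ avoidSet X g b) := by
  have := hX.isProb
  have hβa := pos_of_le ha.le hab hβb
  have hb := ha.trans_le hab
  have hac : tiltMeasure P X β 0 b ≪ P := withDensity_absolutelyContinuous _ _
  have hfin : IsFiniteMeasure (tiltMeasure P X β 0 b) :=
    ⟨by rw [tiltMeasure_univ hX β 0 hb hβb]; exact ENNReal.one_lt_top⟩
  have hfga := fun s (hs : s ∈ Set.Icc 0 a) => hfg s ⟨hs.1, hs.2.trans hab⟩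
  have hσ : a / (1 + β * a) ≤ b / (1 + β * b) := by
    rw [div_le_div_iff₀ hβa hβb]
    nlinarith
  rw [measure_sdiff (avoidSet_anti _ _ hσ)
      (nullMeasurableSet_avoidSet hX (div_pos hb hβb) hf) (measure_ne_top _ _),
    measure_sdiff (avoidSet_anti _ _ hab)
      ((nullMeasurableSet_avoidSet hX hb hg).mono_ac hac) (measure_ne_top _ _),
    ← avoidSet_tiltProc_zero hβa hfga, ← avoidSet_tiltProc_zero hβb hfg,
    measure_avoidSet_tiltProc hX β 0 ha hab hβb (hg.mono (Set.Icc_subset_Icc_right hab)),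
    measure_avoidSet_tiltProc hX β 0 hb le_rfl hβb hg]

lemma sum_measure_sdiff_succ {α : Type*} [MeasurableSpace α] (μ : Measure α)
    {B : ℕ → Set α} {n : ℕ} (hB : ∀ k ≤ n, NullMeasurableSet (B k) μ)
    (hanti : ∀ k < n, B (k + 1) ⊆ B k) :
    ∑ k ∈ Finset.range n, μ (B k \ B (k + 1)) = μ (B 0 \ B n) := by
  have hsub : ∀ k ≤ n, B k ⊆ B 0 := by
    intro k
    induction k with
    | zero => exact fun _ => subset_rfl
    | succ k ih => exact fun hk => (hanti k hk).trans (ih (by omega))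
  have H : ∀ k ≤ n, ∑ i ∈ Finset.range k, μ (B i \ B (i + 1)) = μ (B 0 \ B k) := by
    intro k
    induction k with
    | zero => simp
    | succ k ih =>
      intro hk
      rw [Finset.sum_range_succ, ih (by omega), ← measure_union₀
        ((hB k (by omega)).diff (hB (k + 1) hk))
        (Disjoint.aedisjoint (Set.disjoint_left.2 fun x hx hx' => hx.2 hx'.1))]
      congr 1
      ext x
      have h1 := @hanti k (by omega) x
      have h2 := @hsub k (by omega) x
      simp only [Set.mem_union, Set.mem_sdiff]
      tauto
  exact H n le_rfl

lemma continuousOn_tiltWeight (β θ : ℝ) {S : Set ℝ} (hS : ∀ s ∈ S, 0 < 1 + β * s) {z : ℝ → ℝ}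
    (hz : ContinuousOn z S) : ContinuousOn (fun s => tiltWeight β θ s (z s)) S := by
  unfold tiltWeight
  refine ContinuousOn.mul (ContinuousOn.inv₀ (by fun_prop) fun s hs =>
    (Real.sqrt_pos.2 (hS s hs)).ne') (Real.continuous_exp.comp_continuousOn ?_)
  exact ContinuousOn.div (by fun_prop) (by fun_prop) fun s hs => by
    have := hS s hs
    positivity

/-- The `k`-th point of the subdivision of `[a, b]` into `n + 1` equal intervals. -/
def gridPoint (a b : ℝ) (n k : ℕ) : ℝ := a + k * ((b - a) / (n + 1))

lemma gridPoint_zero (a b : ℝ) (n : ℕ) : gridPoint a b n 0 = a := by simp [gridPoint]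

lemma gridPoint_last (a b : ℝ) (n : ℕ) : gridPoint a b n (n + 1) = b := by
  have : (n : ℝ) + 1 ≠ 0 := by positivity
  simp only [gridPoint, Nat.cast_add, Nat.cast_one]
  field_simp
  ring

lemma gridPoint_succ (a b : ℝ) (n k : ℕ) :
    gridPoint a b n (k + 1) = gridPoint a b n k + (b - a) / (n + 1) := by
  simp only [gridPoint, Nat.cast_add, Nat.cast_one]
  ring

lemma monotone_gridPoint {a b : ℝ} (hab : a ≤ b) (n : ℕ) : Monotone (gridPoint a b n) :=
  monotone_nat_of_le_succ fun k => by
    rw [gridPoint_succ]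
    have : 0 ≤ (b - a) / ((n : ℝ) + 1) := div_nonneg (sub_nonneg.2 hab) (by positivity)
    linarith

lemma gridPoint_mem {a b : ℝ} (hab : a ≤ b) {n k : ℕ} (hk : k ≤ n + 1) :
    gridPoint a b n k ∈ Set.Icc a b := by
  constructor
  · simpa [gridPoint_zero] using monotone_gridPoint hab n (Nat.zero_le k)
  · simpa [gridPoint_last] using monotone_gridPoint hab n hk

/-- The density of the tilted law on the grid interval in which the first crossing occurs. -/
def gridWeight {Ω : Type*} (X : ℝ → Ω → ℝ) (g : ℝ → ℝ) (β a b : ℝ) (n : ℕ) (ω : Ω) : ℝ≥0∞ :=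
  ∑ k ∈ Finset.range (n + 1),
    (avoidSet X g (gridPoint a b n k) \ avoidSet X g (gridPoint a b n (k + 1))).indicator
      (fun ω => ENNReal.ofReal
        (tiltWeight β 0 (gridPoint a b n (k + 1)) (X (gridPoint a b n (k + 1)) ω))) ω

lemma ofReal_le_liminf_gridWeight {Ω : Type*} {X : ℝ → Ω → ℝ} {g : ℝ → ℝ} {β a b : ℝ}
    (ha : 0 < a) (hab : a ≤ b) (hβb : 0 < 1 + β * b) {m : ℝ}
    (hm : ∀ t ∈ Set.Icc a b, m ≤ tiltWeight β 0 t (g t)) {ω : Ω}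
    (hω : Continuous fun t => X t ω) (hA : ω ∈ avoidSet X g a \ avoidSet X g b) :
    ENNReal.ofReal m ≤ liminf (fun n => gridWeight X g β a b n ω) atTop := by
  refine le_of_forall_lt_imp_le_of_dense fun c hc => ?_
  have hcm : c.toReal < m := (ENNReal.lt_ofReal_iff_toReal_lt (hc.trans_le le_top).ne).1 hc
  have hc' : c = ENNReal.ofReal c.toReal := (ENNReal.ofReal_toReal (hc.trans_le le_top).ne).symm
  have hφ : ContinuousOn (fun s => tiltWeight β 0 s (X s ω)) (Set.Icc a b) :=
    continuousOn_tiltWeight β 0 (fun s hs => pos_of_le (ha.le.trans hs.1) hs.2 hβb)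
      hω.continuousOn
  obtain ⟨δ, hδ, huc⟩ := Metric.uniformContinuousOn_iff.1
    (isCompact_Icc.uniformContinuousOn_of_continuous hφ) (m - c.toReal) (sub_pos.2 hcm)
  have hstep : ∀ᶠ n : ℕ in atTop, (b - a) / ((n : ℝ) + 1) < δ := by
    have := (tendsto_one_div_add_atTop_nhds_zero_nat (𝕜 := ℝ)).const_mul (b - a)
    rw [mul_zero] at this
    filter_upwards [this.eventually (gt_mem_nhds hδ)] with n hn
    rwa [← mul_one_div]
  refine le_liminf_of_le (by isBoundedDefault) ?_
  filter_upwards [hstep] with n hn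
  have hex : ∃ k, ω ∉ avoidSet X g (gridPoint a b n k) := ⟨n + 1, by
    rw [gridPoint_last]
    exact hA.2⟩
  obtain ⟨k, hk⟩ : ∃ k, Nat.find hex = k + 1 := Nat.exists_eq_succ_of_ne_zero fun h0 => by
    have := Nat.find_spec hex
    rw [h0, gridPoint_zero] at this
    exact this hA.1
  have hk1 : ω ∈ avoidSet X g (gridPoint a b n k) := by
    by_contra hcon
    exact Nat.find_min hex (by omega) hcon
  have hk2 : ω ∉ avoidSet X g (gridPoint a b n (k + 1)) := hk ▸ Nat.find_spec hex
  have hkn : k + 1 ≤ n + 1 := hk ▸ Nat.find_min' hex (by rw [gridPoint_last]; exact hA.2)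
  obtain ⟨s, hs, hsX⟩ : ∃ s ∈ Set.Icc 0 (gridPoint a b n (k + 1)), X s ω = g s := by
    by_contra! hcon
    exact hk2 hcon
  have hks : gridPoint a b n k < s := by
    by_contra! hcon
    exact hk1 s ⟨hs.1, hcon⟩ hsX
  have hmem1 := gridPoint_mem (n := n) hab (show k ≤ n + 1 by omega)
  have hmem2 := gridPoint_mem (n := n) hab hkn
  have hsmem : s ∈ Set.Icc a b := ⟨hmem1.1.trans hks.le, hs.2.trans hmem2.2⟩
  have hdist : dist s (gridPoint a b n (k + 1)) < δ := by
    rw [Real.dist_eq, abs_sub_comm, abs_of_nonneg (sub_nonneg.2 hs.2)]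
    have := gridPoint_succ a b n k
    linarith
  have h1 := huc s hsmem _ hmem2 hdist
  rw [Real.dist_eq, hsX] at h1
  have h2 := hm s hsmem
  have h3 := (abs_lt.1 h1).2
  rw [hc', gridWeight]
  refine le_trans ?_ (Finset.single_le_sum (fun _ _ => zero_le)
    (Finset.mem_range.2 (show k < n + 1 by omega)))
  rw [Set.indicator_of_mem (show ω ∈ _ \ _ from ⟨hk1, hk2⟩)]
  exact ENNReal.ofReal_le_ofReal (by linarith)

lemma mul_measure_avoidSet_diff_le (hX : IsBrownianMotion X P 0) {β : ℝ} {a b : ℝ} (ha : 0 < a)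
    (hab : a ≤ b) (hβb : 0 < 1 + β * b) {f g : ℝ → ℝ} (hg : ContinuousOn g (Set.Icc 0 b))
    (hf : ContinuousOn f (Set.Icc 0 (b / (1 + β * b))))
    (hfg : ∀ s ∈ Set.Icc 0 b, g s = (1 + β * s) * f (s / (1 + β * s))) {m : ℝ}
    (hm : ∀ t ∈ Set.Icc a b, m ≤ tiltWeight β 0 t (g t)) :
    ENNReal.ofReal m * P (avoidSet X g a \ avoidSet X g b) ≤
      P (avoidSet X f (a / (1 + β * a)) \ avoidSet X f (b / (1 + β * b))) := by
  have hnull : ∀ t ∈ Set.Icc a b, NullMeasurableSet (avoidSet X g t) P := fun t ht =>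
    nullMeasurableSet_avoidSet hX (ha.trans_le ht.1) (hg.mono (Set.Icc_subset_Icc_right ht.2))
  have hσ : ∀ s t, 0 ≤ s → s ≤ t → t ≤ b → s / (1 + β * s) ≤ t / (1 + β * t) := by
    intro s t hs hst htb
    have h1 := pos_of_le (hs.trans hst) htb hβb
    rw [div_le_div_iff₀ (pos_of_le hs hst h1) h1]
    nlinarith
  have hpiece : ∀ n k, k < n + 1 → NullMeasurableSet (avoidSet X g (gridPoint a b n k) \
      avoidSet X g (gridPoint a b n (k + 1))) P := fun n k hk =>
    (hnull _ (gridPoint_mem hab hk.le)).diff (hnull _ (gridPoint_mem hab hk))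
  have hterm : ∀ n k, k < n + 1 → AEMeasurable
      ((avoidSet X g (gridPoint a b n k) \ avoidSet X g (gridPoint a b n (k + 1))).indicator
        fun ω => ENNReal.ofReal (tiltWeight β 0 (gridPoint a b n (k + 1))
          (X (gridPoint a b n (k + 1)) ω))) P := fun n k hk =>
    (((measurable_tiltWeight _ _ _).comp (hX.meas _)).ennreal_ofReal.aemeasurable).indicator₀
      (hpiece n k hk)
  have hmeas : ∀ n, AEMeasurable (gridWeight X g β a b n) P := fun n =>
    Finset.aemeasurable_fun_sum _ fun k hk => hterm n k (Finset.mem_range.1 hk)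
  have hlint : ∀ n, ∫⁻ ω, gridWeight X g β a b n ω ∂P =
      P (avoidSet X f (a / (1 + β * a)) \ avoidSet X f (b / (1 + β * b))) := by
    intro n
    have hsum := sum_measure_sdiff_succ P (n := n + 1)
      (B := fun k => avoidSet X f (gridPoint a b n k / (1 + β * gridPoint a b n k)))
      (fun k hk => by
        have hmem := gridPoint_mem hab hk
        have hpos := ha.trans_le hmem.1
        refine nullMeasurableSet_avoidSet hX
          (div_pos hpos (pos_of_le hpos.le hmem.2 hβb))
          (hf.mono (Set.Icc_subset_Icc_right (hσ _ _ hpos.le hmem.2 le_rfl))))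
      (fun k hk => by
        have hmem := gridPoint_mem hab hk.le
        exact avoidSet_anti _ _ (hσ _ _ (ha.le.trans hmem.1)
          (monotone_gridPoint hab n (Nat.le_succ k)) (gridPoint_mem hab hk).2))
    simp only [gridPoint_zero, gridPoint_last] at hsum
    rw [← hsum]
    unfold gridWeight
    rw [lintegral_finsetSum' _ fun k hk => hterm n k (Finset.mem_range.1 hk)]
    refine Finset.sum_congr rfl fun k hk => ?_
    have hk' := Finset.mem_range.1 hk
    have hmem := gridPoint_mem hab hk'.le
    have hmem' := gridPoint_mem (k := k + 1) hab hk'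
    rw [lintegral_indicator₀ (hpiece n k hk')]
    have hpos' := pos_of_le (ha.le.trans hmem'.1) hmem'.2 hβb
    rw [measure_avoidSet_diff_tilt hX (ha.trans_le hmem.1)
      (monotone_gridPoint hab n (Nat.le_succ k)) hpos'
      (hg.mono (Set.Icc_subset_Icc_right hmem'.2))
      (hf.mono (Set.Icc_subset_Icc_right (hσ _ _ (ha.le.trans hmem'.1) hmem'.2 le_rfl)))
      (fun s hs => hfg s ⟨hs.1, hs.2.trans hmem'.2⟩), tiltMeasure,
      withDensity_apply₀ _ (hpiece n k hk')]
  calc ENNReal.ofReal m * P (avoidSet X g a \ avoidSet X g b)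
      = ∫⁻ ω, (avoidSet X g a \ avoidSet X g b).indicator (fun _ => ENNReal.ofReal m) ω ∂P := by
        rw [lintegral_indicator_const₀
          ((hnull a ⟨le_rfl, hab⟩).diff (hnull b ⟨hab, le_rfl⟩))]
    _ ≤ ∫⁻ ω, liminf (fun n => gridWeight X g β a b n ω) atTop ∂P := by
        refine lintegral_mono_ae ?_
        filter_upwards [hX.cont] with ω hω
        by_cases hA : ω ∈ avoidSet X g a \ avoidSet X g b
        · rw [Set.indicator_of_mem hA]
          exact ofReal_le_liminf_gridWeight ha hab hβb hm hω hA
        · rw [Set.indicator_of_notMem hA]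
          exact zero_le
    _ ≤ liminf (fun n => ∫⁻ ω, gridWeight X g β a b n ω ∂P) atTop :=
        lintegral_liminf_le' hmeas
    _ = _ := by simp only [hlint, liminf_const]

lemma eventually_forall_mem_Icc {α : Type*} {l : Filter α} {u v : α → ℝ} {x : ℝ}
    {Q : ℝ → Prop} (hu : Tendsto u l (𝓝 x)) (hv : Tendsto v l (𝓝 x)) (hQ : ∀ᶠ s in 𝓝 x, Q s) :
    ∀ᶠ h in l, ∀ s ∈ Set.Icc (u h) (v h), Q s :=
  (hu.Icc hv).eventually (eventually_smallSets_forall.2 hQ)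

/-- One half of the identity between densities of first crossing times. -/
lemma tiltWeight_mul_density_le (hX : IsBrownianMotion X P 0) {β t : ℝ} (ht : 0 < t)
    (hβt : 0 < 1 + β * t) {f g p q : ℝ → ℝ}
    (hg : ContinuousOn g {s | 0 ≤ s ∧ 0 < 1 + β * s})
    (hf : ContinuousOn f {s | 0 ≤ s ∧ 0 < 1 - β * s})
    (hfg : ∀ s, 0 ≤ s → 0 < 1 + β * s → g s = (1 + β * s) * f (s / (1 + β * s)))
    (hq : ∀ a b, 0 < a → a ≤ b → 0 < 1 + β * b →
      P (avoidSet X g a \ avoidSet X g b) = ∫⁻ s in Set.Ioc a b, ENNReal.ofReal (q s))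
    (hp : ∀ a b, 0 < a → a ≤ b → 0 < 1 - β * b →
      P (avoidSet X f a \ avoidSet X f b) = ∫⁻ s in Set.Ioc a b, ENNReal.ofReal (p s))
    (hqc : ContinuousAt q t) (hpc : ContinuousAt p (t / (1 + β * t))) :
    tiltWeight β 0 t (g t) * max (q t) 0 ≤ max (p (t / (1 + β * t))) 0 * (1 / (1 + β * t) ^ 2) := by
  by_contra! hcon
  set M := tiltWeight β 0 t (g t) with hM
  set Q := max (q t) 0 with hQ
  set R := max (p (t / (1 + β * t))) 0 with hR
  set S := 1 / (1 + β * t) ^ 2 with hS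
  have hM0 : 0 < M := tiltWeight_pos hβt
  have hR0 : 0 ≤ R := le_max_right _ _
  have hS0 : 0 < S := by positivity
  have hQ0 : 0 < Q := by
    by_contra! h
    have := mul_nonneg hR0 hS0.le
    nlinarith
  obtain ⟨ε, ⟨⟨h1, h2⟩, h3⟩, hε⟩ : ∃ ε : ℝ, (((R + ε) * (S + ε) < (M - ε) * (Q - ε) ∧ ε < M) ∧
      ε < Q) ∧ 0 < ε := by
    have e1 : ∀ᶠ ε : ℝ in 𝓝 0, (R + ε) * (S + ε) < (M - ε) * (Q - ε) := by
      refine ContinuousAt.eventually_lt (by fun_prop) (by fun_prop) ?_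
      simpa using hcon
    have e2 := (((e1.and (gt_mem_nhds hM0)).and (gt_mem_nhds hQ0)).filter_mono
      (nhdsWithin_le_nhds (s := Set.Ioi 0))).and self_mem_nhdsWithin
    exact e2.exists
  have hdom : {s : ℝ | 0 ≤ s ∧ 0 < 1 + β * s} ∈ 𝓝 t := by
    have e1 : ∀ᶠ s : ℝ in 𝓝 t, 0 < 1 + β * s :=
      ContinuousAt.eventually_lt (by fun_prop) (by fun_prop) hβt
    filter_upwards [e1, lt_mem_nhds ht] with s hs hs' using ⟨hs'.le, hs⟩
  have hMc : ContinuousAt (fun s => tiltWeight β 0 s (g s)) t :=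
    (continuousOn_tiltWeight β 0 (fun s hs => hs.2) hg).continuousAt hdom
  have htend : Tendsto (fun h : ℝ => t + h) (𝓝[>] 0) (𝓝 t) := by
    refine tendsto_nhdsWithin_of_tendsto_nhds ?_
    have : ContinuousAt (fun h : ℝ => t + h) 0 := by fun_prop
    simpa [ContinuousAt] using this
  have hσtend : Tendsto (fun h : ℝ => (t + h) / (1 + β * (t + h))) (𝓝[>] 0)
      (𝓝 (t / (1 + β * t))) := by
    have : ContinuousAt (fun s : ℝ => s / (1 + β * s)) t :=
      ContinuousAt.div (by fun_prop) (by fun_prop) hβt.ne'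
    exact this.tendsto.comp htend
  have ev1 : ∀ᶠ h in 𝓝[>] (0 : ℝ), 0 < 1 + β * (t + h) := by
    have e1 : ∀ᶠ s : ℝ in 𝓝 t, 0 < 1 + β * s :=
      ContinuousAt.eventually_lt (by fun_prop) (by fun_prop) hβt
    exact htend.eventually e1
  have ev2 : ∀ᶠ h in 𝓝[>] (0 : ℝ), ∀ s ∈ Set.Icc t (t + h), M - ε ≤ tiltWeight β 0 s (g s) :=
    eventually_forall_mem_Icc tendsto_const_nhds htend
      ((hMc.eventually (lt_mem_nhds (sub_lt_self M hε))).mono fun _ h => h.le)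
  have ev3 : ∀ᶠ h in 𝓝[>] (0 : ℝ), ∀ s ∈ Set.Icc t (t + h), Q - ε < max (q s) 0 :=
    eventually_forall_mem_Icc tendsto_const_nhds htend
      ((hqc.max continuousAt_const).eventually (lt_mem_nhds (sub_lt_self Q hε)))
  have ev4 : ∀ᶠ h in 𝓝[>] (0 : ℝ), ∀ s ∈ Set.Icc (t / (1 + β * t))
      ((t + h) / (1 + β * (t + h))), max (p s) 0 < R + ε :=
    eventually_forall_mem_Icc tendsto_const_nhds hσtend
      ((hpc.max continuousAt_const).eventually (gt_mem_nhds (lt_add_of_pos_right R hε)))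
  have ev5 : ∀ᶠ h in 𝓝[>] (0 : ℝ), 1 / ((1 + β * t) * (1 + β * (t + h))) < S + ε := by
    have : ContinuousAt (fun s : ℝ => 1 / ((1 + β * t) * (1 + β * s))) t :=
      ContinuousAt.div (by fun_prop) (by fun_prop) (mul_pos hβt hβt).ne'
    refine (this.tendsto.comp htend).eventually (gt_mem_nhds ?_)
    rw [hS, sq]
    exact lt_add_of_pos_right _ hε
  obtain ⟨h, ⟨⟨⟨⟨hv1, hv2⟩, hv3⟩, hv4⟩, hv5⟩, hh⟩ :=
    (((((ev1.and ev2).and ev3).and ev4).and ev5).and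
      (self_mem_nhdsWithin : Set.Ioi (0 : ℝ) ∈ 𝓝[>] 0)).exists
  have hh : 0 < h := hh
  set σ' := (t + h) / (1 + β * (t + h)) with hσ'
  have hσpos : 0 < t / (1 + β * t) := div_pos ht hβt
  have hdiff : σ' - t / (1 + β * t) = h * (1 / ((1 + β * t) * (1 + β * (t + h)))) := by
    rw [hσ', div_sub_div _ _ hv1.ne' hβt.ne', mul_one_div]
    congr 1 <;> ring
  have hdiff0 : 0 ≤ h * (1 / ((1 + β * t) * (1 + β * (t + h)))) := by positivity
  have hσle : t / (1 + β * t) ≤ σ' := by linarith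
  have hσdom : ∀ s, 0 ≤ s → s ≤ σ' → 0 < 1 - β * s := by
    intro s hs hs'
    have e : 0 < 1 + -β * σ' := by
      have : 1 + -β * σ' = 1 / (1 + β * (t + h)) := by
        rw [hσ', eq_div_iff hv1.ne', add_mul, mul_assoc, div_mul_cancel₀ _ hv1.ne']
        ring
      rw [this]
      positivity
    have := pos_of_le hs hs' e
    linarith
  have hcore := mul_measure_avoidSet_diff_le hX ht (le_add_of_nonneg_right hh.le) hv1
    (hg.mono fun s hs => ⟨hs.1, pos_of_le hs.1 hs.2 hv1⟩)
    (hf.mono fun s hs => ⟨hs.1, hσdom s hs.1 hs.2⟩)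
    (fun s hs => hfg s hs.1 (pos_of_le hs.1 hs.2 hv1)) hv2
  rw [hq t (t + h) ht (le_add_of_nonneg_right hh.le) hv1,
    hp _ σ' hσpos hσle (hσdom σ' (hσpos.le.trans hσle) le_rfl)] at hcore
  have hlow : ENNReal.ofReal (Q - ε) * ENNReal.ofReal h ≤
      ∫⁻ s in Set.Ioc t (t + h), ENNReal.ofReal (q s) := by
    calc ENNReal.ofReal (Q - ε) * ENNReal.ofReal h
        = ∫⁻ _ in Set.Ioc t (t + h), ENNReal.ofReal (Q - ε) := by
          rw [setLIntegral_const, Real.volume_Ioc, add_sub_cancel_left]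
      _ ≤ _ := setLIntegral_mono' measurableSet_Ioc fun s hs => by
          have := hv3 s (Set.Ioc_subset_Icc_self hs)
          rcases lt_max_iff.1 this with h' | h'
          · exact ENNReal.ofReal_le_ofReal h'.le
          · linarith
  have hup : ∫⁻ s in Set.Ioc (t / (1 + β * t)) σ', ENNReal.ofReal (p s) ≤
      ENNReal.ofReal (R + ε) * ENNReal.ofReal (σ' - t / (1 + β * t)) := by
    rw [← Real.volume_Ioc, ← setLIntegral_const]
    exact setLIntegral_mono' measurableSet_Ioc fun s hs =>
      ENNReal.ofReal_le_ofReal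
        ((le_max_left _ _).trans (hv4 s (Set.Ioc_subset_Icc_self hs)).le)
  have hfinal := ((mul_le_mul_right hlow (ENNReal.ofReal (M - ε))).trans hcore).trans hup
  rw [← ENNReal.ofReal_mul (by linarith), ← ENNReal.ofReal_mul (by linarith),
    ← ENNReal.ofReal_mul (by linarith), hdiff,
    ENNReal.ofReal_le_ofReal_iff (mul_nonneg (by linarith) hdiff0)] at hfinal
  have h5 : (R + ε) * (h * (1 / ((1 + β * t) * (1 + β * (t + h))))) ≤
      (R + ε) * (h * (S + ε)) := by
    gcongr
  nlinarith

lemma ofReal_lt_hitTimeUntil_iff {Ω : Type*} {X : ℝ → Ω → ℝ} {β a : ℝ} {g : ℝ → ℝ} {ω : Ω}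
    (ha : 0 < a) (hβa : 0 < 1 + β * a) (hg : ContinuousAt g a) (hg0 : g 0 ≠ 0)
    (hω : Continuous fun t => X t ω) (h0 : X 0 ω = 0) :
    ENNReal.ofReal a < hitTimeUntil X β g ω ↔ ω ∈ avoidSet X g a := by
  constructor
  · intro h s hs hXs
    rcases hs.1.eq_or_lt with rfl | hs0
    · exact hg0 (hXs.symm.trans h0)
    · have h1 : hitTimeUntil X β g ω ≤ ENNReal.ofReal s :=
        iInf₂_le s ⟨hs0, pos_of_le hs.1 hs.2 hβa, hXs⟩
      exact absurd (h.trans_le (h1.trans (ENNReal.ofReal_le_ofReal hs.2))) (lt_irrefl _)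
  · intro h
    have hne : ∀ᶠ s in 𝓝 a, X s ω ≠ g s :=
      ((hω.continuousAt.sub hg).eventually_ne (sub_ne_zero.2 (h a ⟨ha.le, le_rfl⟩))).mono
        fun _ => sub_ne_zero.1
    obtain ⟨δ, hδ, hball⟩ := Metric.eventually_nhds_iff.1 hne
    refine lt_of_lt_of_le ((ENNReal.ofReal_lt_ofReal_iff (by linarith)).2
      (show a < a + δ by linarith)) (le_iInf₂ fun s hs => ENNReal.ofReal_le_ofReal ?_)
    by_contra! hcon
    rcases le_total s a with hsa | hsa
    · exact h s ⟨hs.1.le, hsa⟩ hs.2.2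
    · refine hball ?_ hs.2.2
      rw [Real.dist_eq, abs_of_nonneg (by linarith)]
      linarith

lemma mem_image_ofReal_Ioc {a b : ℝ} (ha : 0 ≤ a) (hab : a ≤ b) (x : ℝ≥0∞) :
    x ∈ ENNReal.ofReal '' Set.Ioc a b ↔ ENNReal.ofReal a < x ∧ x ≤ ENNReal.ofReal b := by
  constructor
  · rintro ⟨s, hs, rfl⟩
    exact ⟨(ENNReal.ofReal_lt_ofReal_iff (ha.trans_lt hs.1)).2 hs.1,
      ENNReal.ofReal_le_ofReal hs.2⟩
  · rintro ⟨h1, h2⟩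
    have hx : x ≠ ⊤ := (h2.trans_lt ENNReal.ofReal_lt_top).ne
    refine ⟨x.toReal, ⟨(ENNReal.ofReal_lt_iff_lt_toReal ha hx).1 h1, ?_⟩,
      ENNReal.ofReal_toReal hx⟩
    by_contra! hcon
    exact absurd h2 (not_le.2 ((ENNReal.ofReal_lt_iff_lt_toReal (ha.trans hab) hx).2 hcon))

lemma measure_avoidSet_diff_eq_lintegral (hX : IsBrownianMotion X P 0) {β a b : ℝ}
    {g q : ℝ → ℝ} (ha : 0 < a) (hab : a ≤ b) (hβb : 0 < 1 + β * b) (hga : ContinuousAt g a)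
    (hgb : ContinuousAt g b) (hg0 : g 0 ≠ 0) (hq : HasHitDensity (hitTimeUntil X β g) P q) :
    P (avoidSet X g a \ avoidSet X g b) = ∫⁻ s in Set.Ioc a b, ENNReal.ofReal (q s) := by
  rw [← hq (Set.Ioc a b) measurableSet_Ioc fun s hs => ha.trans hs.1]
  refine measure_congr ?_
  filter_upwards [hX.cont, hX.init] with ω hω h0
  refine propext ?_
  change ω ∈ avoidSet X g a \ avoidSet X g b ↔
    hitTimeUntil X β g ω ∈ ENNReal.ofReal '' Set.Ioc a b
  rw [mem_image_ofReal_Ioc ha.le hab, Set.mem_sdiff,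
    ofReal_lt_hitTimeUntil_iff ha (pos_of_le ha.le hab hβb) hga hg0 hω h0, ← not_lt,
    ofReal_lt_hitTimeUntil_iff (ha.trans_le hab) hβb hgb hg0 hω h0]

lemma hitTimeUntil_zero {Ω : Type*} (X : ℝ → Ω → ℝ) (f : ℝ → ℝ) :
    hitTimeUntil X 0 f = hitTime X f := by
  funext ω
  simp [hitTimeUntil, hitTime]


lemma exists_nat_forall_pos_add_mul {a : ℝ} (ha : 0 ≤ a) {d : ℝ → ℝ}
    (hd : ContinuousOn d (Set.Icc 0 a)) (hd0 : 0 < d 0) :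
    ∃ n : ℕ, ∀ s ∈ Set.Icc 0 a, 0 < d s + n * s := by
  obtain ⟨δ, hδ, hpos⟩ := Metric.eventually_nhds_iff.1 (eventually_nhdsWithin_iff.1
    ((hd 0 ⟨le_rfl, ha⟩).eventually (lt_mem_nhds hd0)))
  obtain ⟨C, hC⟩ := isCompact_Icc.exists_bound_of_continuousOn hd
  obtain ⟨n, hn⟩ := exists_nat_gt (C / δ)
  refine ⟨n, fun s hs => ?_⟩
  rcases lt_or_ge s δ with h | h
  · have := hpos (by rwa [Real.dist_eq, sub_zero, abs_of_nonneg hs.1]) hs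
    have := mul_nonneg (Nat.cast_nonneg (α := ℝ) n) hs.1
    linarith
  · have h1 := (abs_le.1 (hC s hs)).1
    have h2 := (div_lt_iff₀ hδ).1 hn
    have h3 := mul_le_mul_of_nonneg_left h (Nat.cast_nonneg (α := ℝ) n)
    linarith

lemma tiltProc_zero_left {Ω : Type*} (θ : ℝ) (X : ℝ → Ω → ℝ) (t : ℝ) (ω : Ω) :
    tiltProc 0 θ X t ω = X t ω + θ * t := by
  simp [tiltProc]

lemma tiltWeight_zero_left (θ t x : ℝ) :
    tiltWeight 0 θ t x = Real.exp (θ * x - θ ^ 2 * t / 2) := by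
  simp only [tiltWeight, zero_mul, add_zero, Real.sqrt_one, inv_one, one_mul, zero_add, mul_one]
  congr 1
  ring

lemma measure_avoidSet_ne_zero (hX : IsBrownianMotion X P 0) {a : ℝ} (ha : 0 < a) {g : ℝ → ℝ}
    (hg : ContinuousOn g (Set.Icc 0 a)) (hg0 : g 0 ≠ 0) : P (avoidSet X g a) ≠ 0 := by
  have := hX.isProb
  intro hnull
  obtain ⟨ε, hε, hεg⟩ : ∃ ε : ℝ, ε ^ 2 = 1 ∧ 0 < ε * g 0 := by
    rcases hg0.lt_or_gt with h | h
    · exact ⟨-1, by norm_num, by linarith⟩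
    · exact ⟨1, by norm_num, by linarith⟩
  have hn : ∀ n : ℕ, P (avoidSet (tiltProc 0 (-ε * n) X) g a) = 0 := fun n => by
    rw [measure_avoidSet_tiltProc hX 0 (-ε * n) ha le_rfl (by simp) hg]
    exact withDensity_absolutelyContinuous _ _ hnull
  have hall : ∀ᵐ ω ∂P, ∃ n : ℕ, ω ∈ avoidSet (tiltProc 0 (-ε * n) X) g a := by
    filter_upwards [hX.cont, hX.init] with ω hω h0
    obtain ⟨n, hpos⟩ := exists_nat_forall_pos_add_mul ha.le (d := fun s => ε * (g s - X s ω))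
      (continuousOn_const.mul (hg.sub hω.continuousOn)) (by simpa [h0] using hεg)
    refine ⟨n, fun s hs heq => (hpos s hs).ne' ?_⟩
    rw [tiltProc_zero_left] at heq
    rw [← heq]
    linear_combination -(n * s) * hε
  obtain ⟨ω, ⟨n, hω⟩, hnot⟩ :=
    (hall.and (ae_all_iff.2 fun n => measure_eq_zero_iff_ae_notMem.1 (hn n))).exists
  exact hnot n hω

lemma exists_lt_of_exp_bound {c L δ : ℝ} (hc : 0 < c) (hL : 0 ≤ L) (hδ : 0 < δ) :
    ∃ x : ℝ, 0 < x ∧ Real.exp (x * L - x ^ 2 * δ) < c := by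
  set x := max ((L + 1) / δ) (1 - Real.log c) with hx
  have h1 : L + 1 ≤ x * δ := (div_le_iff₀ hδ).1 (le_max_left _ _)
  have h2 : 1 - Real.log c ≤ x := le_max_right _ _
  have hx0 : 0 < x := lt_of_lt_of_le (by positivity) (le_max_left _ _)
  refine ⟨x, hx0, (Real.lt_log_iff_exp_lt hc).1 ?_⟩
  nlinarith

lemma mul_pos_of_mem_avoidSet {Ω : Type*} {X : ℝ → Ω → ℝ} {g : ℝ → ℝ} {b ε : ℝ} {ω : Ω}
    (hb : 0 ≤ b) (hε : ε ^ 2 = 1) (hg : ContinuousOn g (Set.Icc 0 b))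
    (hω : Continuous fun t => X t ω) (h0 : X 0 ω = 0) (hεg : 0 < ε * g 0)
    (h : ω ∈ avoidSet X g b) : 0 < ε * (g b - X b ω) := by
  by_contra! hcon
  obtain ⟨s, hs, hs0⟩ := intermediate_value_Icc' hb
    (f := fun s => ε * (g s - X s ω)) (continuousOn_const.mul (hg.sub hω.continuousOn))
    (show (0 : ℝ) ∈ _ from ⟨hcon, by simpa [h0] using hεg.le⟩)
  refine h s hs ?_
  linear_combination (g s - X s ω) * hε - ε * hs0

lemma measure_avoidSet_diff_ne_zero (hX : IsBrownianMotion X P 0) {a b : ℝ} (ha : 0 < a)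
    (hab : a < b) {g : ℝ → ℝ} (hg : ContinuousOn g (Set.Icc 0 b)) (hg0 : g 0 ≠ 0) :
    P (avoidSet X g a \ avoidSet X g b) ≠ 0 := by
  have := hX.isProb
  have hb := ha.trans hab
  intro hnull
  have hga : ContinuousOn g (Set.Icc 0 a) := hg.mono (Set.Icc_subset_Icc_right hab.le)
  obtain ⟨ε, hε, hεg⟩ : ∃ ε : ℝ, ε ^ 2 = 1 ∧ 0 < ε * g 0 := by
    rcases hg0.lt_or_gt with h | h
    · exact ⟨-1, by norm_num, by linarith⟩
    · exact ⟨1, by norm_num, by linarith⟩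
  have hεabs : |ε| = 1 := by
    rw [← sq_eq_sq₀ (abs_nonneg ε) zero_le_one]
    simpa using hε
  obtain ⟨K, hK⟩ : ∃ K : ℕ, P (avoidSet X g a ∩ {ω | |X a ω| ≤ K}) ≠ 0 := by
    by_contra! hcon
    refine measure_avoidSet_ne_zero hX ha hga hg0 (measure_mono_null (fun ω hω => ?_)
      (measure_iUnion_null hcon))
    obtain ⟨K, hK⟩ := exists_nat_ge |X a ω|
    exact Set.mem_iUnion.2 ⟨K, hω, hK⟩
  set S := avoidSet X g a ∩ {ω | |X a ω| ≤ K} with hS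
  have hSm : NullMeasurableSet S P := (nullMeasurableSet_avoidSet hX ha hga).inter
    (measurableSet_le (hX.meas a).abs measurable_const).nullMeasurableSet
  have hc : 0 < (P S).toReal := ENNReal.toReal_pos hK (measure_ne_top _ _)
  obtain ⟨x, hx, hxc⟩ := exists_lt_of_exp_bound hc
    (add_nonneg (abs_nonneg (g b)) (Nat.cast_nonneg (α := ℝ) K)) (half_pos (sub_pos.2 hab))
  have hupper : tiltMeasure P X 0 (ε * x) b (avoidSet X g b) ≤
      ENNReal.ofReal (Real.exp (x * |g b| - x ^ 2 * b / 2)) := by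
    rw [tiltMeasure, withDensity_apply' _ _]
    calc ∫⁻ ω in avoidSet X g b, ENNReal.ofReal (tiltWeight 0 (ε * x) b (X b ω)) ∂P
        ≤ ∫⁻ _ in avoidSet X g b,
            ENNReal.ofReal (Real.exp (x * |g b| - x ^ 2 * b / 2)) ∂P := by
          refine lintegral_mono_ae ((ae_restrict_iff'₀ (nullMeasurableSet_avoidSet hX hb hg)).2 ?_)
          filter_upwards [hX.cont, hX.init] with ω hω h0 hmem
          have h1 := mul_pos_of_mem_avoidSet hb.le hε hg hω h0 hεg hmem
          have h2 : ε * g b ≤ |g b| := by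
            simpa [abs_mul, hεabs] using le_abs_self (ε * g b)
          rw [tiltWeight_zero_left]
          refine ENNReal.ofReal_le_ofReal (Real.exp_le_exp.2 ?_)
          rw [mul_pow, hε]
          nlinarith
      _ ≤ _ := by
          rw [setLIntegral_const]
          exact mul_le_of_le_one_right' prob_le_one
  have hlower : ENNReal.ofReal (Real.exp (-(x * K) - x ^ 2 * a / 2)) * P S ≤
      tiltMeasure P X 0 (ε * x) a (avoidSet X g a) := by
    refine le_trans ?_ (measure_mono (Set.inter_subset_left : S ⊆ _))
    rw [tiltMeasure, withDensity_apply' _ _, ← setLIntegral_const]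
    refine lintegral_mono_ae ((ae_restrict_iff'₀ hSm).2 (Eventually.of_forall fun ω hω => ?_))
    have h2 : -(K : ℝ) ≤ ε * X a ω := by
      have h3 := neg_abs_le (ε * X a ω)
      rw [abs_mul, hεabs, one_mul] at h3
      have h4 : |X a ω| ≤ K := hω.2
      linarith
    rw [tiltWeight_zero_left]
    refine ENNReal.ofReal_le_ofReal (Real.exp_le_exp.2 ?_)
    rw [mul_pow, hε]
    nlinarith
  have hswitch : tiltMeasure P X 0 (ε * x) a (avoidSet X g a) ≤
      tiltMeasure P X 0 (ε * x) b (avoidSet X g b) := by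
    rw [← measure_avoidSet_tiltProc hX 0 (ε * x) ha le_rfl (by simp) hga,
      measure_avoidSet_tiltProc hX 0 (ε * x) ha hab.le (by simp) hga]
    refine measure_mono_ae ?_
    refine (ae_le_set.2 ?_)
    exact withDensity_absolutelyContinuous _ _ hnull
  have hfin := (hlower.trans hswitch).trans hupper
  rw [← ENNReal.ofReal_toReal (measure_ne_top P S), ← ENNReal.ofReal_mul (Real.exp_nonneg _),
    ENNReal.ofReal_le_ofReal_iff (Real.exp_nonneg _)] at hfin
  have hlt := mul_lt_mul_of_pos_left hxc (Real.exp_pos (-(x * K) - x ^ 2 * a / 2))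
  rw [← Real.exp_add] at hlt
  refine absurd (hlt.trans_le hfin) (not_lt.2 (Real.exp_le_exp.2 (le_of_eq ?_)))
  ring

/-- A density of the first crossing time is nonnegative where it is continuous. -/
lemma density_nonneg (hX : IsBrownianMotion X P 0) {β t : ℝ} (ht : 0 < t)
    (hβt : 0 < 1 + β * t) {g q : ℝ → ℝ} (hg : ContinuousOn g {s | 0 ≤ s ∧ 0 < 1 + β * s})
    (hg0 : g 0 ≠ 0)
    (hq : ∀ a b, 0 < a → a ≤ b → 0 < 1 + β * b →
      P (avoidSet X g a \ avoidSet X g b) = ∫⁻ s in Set.Ioc a b, ENNReal.ofReal (q s))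
    (hqc : ContinuousAt q t) : 0 ≤ q t := by
  by_contra! hneg
  have hβ : ∀ᶠ s : ℝ in 𝓝 t, 0 < 1 + β * s :=
    ContinuousAt.eventually_lt (by fun_prop) (by fun_prop) hβt
  obtain ⟨δ, hδ, hball⟩ := Metric.eventually_nhds_iff.1
    ((hqc.eventually (gt_mem_nhds hneg)).and hβ)
  have hmem : ∀ s ∈ Set.Ioc t (t + δ / 2), dist s t < δ := fun s hs => by
    rw [Real.dist_eq, abs_of_pos (by linarith [hs.1])]
    linarith [hs.2]
  have htb : t < t + δ / 2 := by linarith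
  have hβb : 0 < 1 + β * (t + δ / 2) := (hball (hmem _ ⟨htb, le_rfl⟩)).2
  refine measure_avoidSet_diff_ne_zero hX ht htb
    (hg.mono fun s hs => ⟨hs.1, pos_of_le hs.1 hs.2 hβb⟩) hg0 ?_
  rw [hq _ _ ht htb.le hβb]
  exact setLIntegral_eq_zero measurableSet_Ioc fun s hs =>
    ENNReal.ofReal_of_nonpos (hball (hmem s hs)).1.le

lemma mem_nhds_tiltDomain {β t : ℝ} (ht : 0 < t) (hβt : 0 < 1 + β * t) :
    {s : ℝ | 0 < s ∧ 0 < 1 + β * s} ∈ 𝓝 t :=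
  (lt_mem_nhds ht).and
    (ContinuousAt.eventually_lt (f := fun _ : ℝ => (0 : ℝ)) (g := fun s => 1 + β * s)
      (by fun_prop) (by fun_prop) hβt)

lemma continuousOn_Sb {f : ℝ → ℝ} (hf : ContinuousOn f (Set.Ici 0)) (β : ℝ) :
    ContinuousOn (Sb β f) {s | 0 ≤ s ∧ 0 < 1 + β * s} := by
  refine ContinuousOn.mul (by fun_prop) (hf.comp
    (continuousOn_id.div (by fun_prop) fun s hs => hs.2.ne') fun s hs => ?_)
  exact div_nonneg hs.1 hs.2.le

end Brownian

/-- **Brownian boundary crossing identity for densities.**  For a standard Brownian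
motion from `0` and `f ∈ C¹(ℝ₊)` with `f 0 ≠ 0`, the continuous densities of `T^f`
and `T^{f^{(β)}}` satisfy, for all `t < ζ^{(β)}`,
`p^{f^{(β)}}(t) = (1+βt)^{-3/2} exp(-(β/2)(f^{(β)}(t))²/(1+βt)) p^f(t/(1+βt))`. -/
theorem brownian_density_identity
    {Ω : Type*} [MeasurableSpace Ω] (X : ℝ → Ω → ℝ) (P : Measure Ω)
    (hX : IsBrownianMotion X P 0)
    (f : ℝ → ℝ) (hf : ContDiffOn ℝ 1 f (Set.Ici 0)) (hne : f 0 ≠ 0) (β : ℝ)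
    (p pβ : ℝ → ℝ)
    (hp : HasHitDensity (hitTime X f) P p) (hpc : ContinuousOn p (Set.Ioi 0))
    (hpβ : HasHitDensity (hitTimeUntil X β (Sb β f)) P pβ)
    (hpβc : ContinuousOn pβ {t | 0 < t ∧ 0 < 1 + β * t}) :
    ∀ t : ℝ, 0 < t → 0 < 1 + β * t →
      pβ t = (1 + β * t) ^ (-(3 : ℝ) / 2) *
        Real.exp (-(β / 2) * (Sb β f t) ^ 2 / (1 + β * t)) * p (t / (1 + β * t)) := by
  intro t ht hβt
  have hfc : ContinuousOn f (Set.Ici 0) := hf.continuousOn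
  have hgc := continuousOn_Sb hfc β
  have hg0 : Sb β f 0 ≠ 0 := by simpa [Sb] using hne
  have hfc' : ContinuousOn f {s | 0 ≤ s ∧ 0 < 1 - β * s} := hfc.mono fun s hs => hs.1
  have hfat : ∀ s, 0 < s → ContinuousAt f s := fun s hs => hfc.continuousAt (Ici_mem_nhds hs)
  have hgat : ∀ s, 0 < s → 0 < 1 + β * s → ContinuousAt (Sb β f) s := fun s hs hs' =>
    hgc.continuousAt (mem_of_superset (mem_nhds_tiltDomain hs hs') fun _ h => ⟨h.1.le, h.2⟩)
  have hqd : ∀ a b, 0 < a → a ≤ b → 0 < 1 + β * b →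
      P (avoidSet X (Sb β f) a \ avoidSet X (Sb β f) b) =
        ∫⁻ s in Set.Ioc a b, ENNReal.ofReal (pβ s) := fun a b ha hab hb =>
    measure_avoidSet_diff_eq_lintegral hX ha hab hb (hgat a ha (pos_of_le ha.le hab hb))
      (hgat b (ha.trans_le hab) hb) hg0 hpβ
  have hpd : ∀ a b, 0 < a → a ≤ b →
      P (avoidSet X f a \ avoidSet X f b) = ∫⁻ s in Set.Ioc a b, ENNReal.ofReal (p s) :=
    fun a b ha hab => measure_avoidSet_diff_eq_lintegral (β := 0) hX ha hab (by simp)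
      (hfat a ha) (hfat b (ha.trans_le hab)) hne (by rwa [hitTimeUntil_zero])
  have hqat : ContinuousAt pβ t := hpβc.continuousAt (mem_nhds_tiltDomain ht hβt)
  set σ := t / (1 + β * t) with hσ
  have hσ0 : 0 < σ := div_pos ht hβt
  have hpat : ContinuousAt p σ := hpc.continuousAt (Ioi_mem_nhds hσ0)
  have hσ1 : 1 + -β * σ = 1 / (1 + β * t) := by
    rw [hσ]
    field_simp
    ring
  have hσt : σ / (1 + -β * σ) = t := by
    rw [hσ1, hσ, div_div_div_cancel_right₀ hβt.ne', div_one]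
  have hσpos : 0 < 1 + -β * σ := by
    rw [hσ1]
    positivity
  have hq0 : 0 ≤ pβ t := density_nonneg hX ht hβt hgc hg0 hqd hqat
  have hp0 : 0 ≤ p σ := density_nonneg (β := 0) hX hσ0 (by simp) (hfc.mono fun s hs => hs.1) hne
    (fun a b ha hab _ => hpd a b ha hab) hpat
  have h1 := tiltWeight_mul_density_le hX ht hβt hgc hfc' (fun s _ _ => rfl) hqd
    (fun a b ha hab _ => hpd a b ha hab) hqat hpat
  have h2 := tiltWeight_mul_density_le (β := -β) (f := Sb β f) (g := f) (p := pβ) (q := p)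
    hX hσ0 hσpos (hfc.mono fun s hs => hs.1)
    (hgc.mono fun s hs => ⟨hs.1, by simpa using hs.2⟩)
    (fun s hs hs' => by
      have e1 : 1 + β * (s / (1 + -β * s)) = 1 / (1 + -β * s) := by
        rw [eq_div_iff hs'.ne', add_mul, mul_assoc, div_mul_cancel₀ _ hs'.ne']
        ring
      simp only [Sb]
      rw [e1, div_div_eq_mul_div, div_one, div_mul_cancel₀ _ hs'.ne', ← mul_assoc,
        mul_one_div_cancel hs'.ne', one_mul])
    (fun a b ha hab _ => hpd a b ha hab)
    (fun a b ha hab hb => hqd a b ha hab (by simpa using hb)) hpat (by rwa [hσt])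
  rw [hσt, hσ1] at h2
  rw [max_eq_left hq0, max_eq_left hp0] at h1 h2
  have hw1 : tiltWeight β 0 t (Sb β f t) =
      (Real.sqrt (1 + β * t))⁻¹ * Real.exp (β * Sb β f t ^ 2 / (2 * (1 + β * t))) := by
    simp [tiltWeight]
  have hfσ : f σ = Sb β f t / (1 + β * t) := by
    rw [Sb, mul_div_cancel_left₀ _ hβt.ne']
  have hw2 : tiltWeight (-β) 0 σ (f σ) =
      Real.sqrt (1 + β * t) * Real.exp (-(β * Sb β f t ^ 2 / (2 * (1 + β * t)))) := by
    simp only [tiltWeight, hσ1, hfσ]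
    rw [Real.sqrt_div zero_le_one, Real.sqrt_one, one_div, inv_inv]
    congr 2
    field_simp
    ring
  rw [hw1] at h1
  rw [hw2] at h2
  have hexp : -(β / 2) * Sb β f t ^ 2 / (1 + β * t) =
      -(β * Sb β f t ^ 2 / (2 * (1 + β * t))) := by
    field_simp
  have hpow : (1 + β * t) ^ (-(3 : ℝ) / 2) = Real.sqrt (1 + β * t) / (1 + β * t) ^ 2 := by
    rw [Real.sqrt_eq_rpow, ← Real.rpow_natCast, ← Real.rpow_sub hβt]
    norm_num
  rw [hexp, hpow]
  set r := Real.sqrt (1 + β * t) with hr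
  set e := β * Sb β f t ^ 2 / (2 * (1 + β * t)) with he
  have hr0 : 0 < r := Real.sqrt_pos.2 hβt
  have hE : Real.exp e * Real.exp (-e) = 1 := by rw [← Real.exp_add, add_neg_cancel, Real.exp_zero]
  have hEpos := Real.exp_pos (-e)
  apply le_antisymm
  · have h3 := mul_le_mul_of_nonneg_left h1 (mul_pos hr0 hEpos).le
    calc pβ t = (r * r⁻¹) * (Real.exp e * Real.exp (-e)) * pβ t := by
          rw [hE, mul_inv_cancel₀ hr0.ne', one_mul, one_mul]
      _ = r * Real.exp (-e) * (r⁻¹ * Real.exp e * pβ t) := by ring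
      _ ≤ _ := h3
      _ = _ := by ring
  · have h3 := mul_le_mul_of_nonneg_left h2 (show 0 ≤ 1 / (1 + β * t) ^ 2 by positivity)
    calc _ = 1 / (1 + β * t) ^ 2 * (r * Real.exp (-e) * p σ) := by ring
      _ ≤ _ := h3
      _ = pβ t := by field_simp

end
end

section
/- Let X be a standard Brownian motion started at 0, f∈C¹(ℝ₊,ℝ) with f(0)≠0, and β>0. Then the density p^{f^{(β)}} of T^{f^{(β)}} satisfies the asymptotic equivalence p^{f^{(β)}}(t) ~ (βt)^{-3/2} · exp(-(β/2)·(f^{(β)}(t))²/(1+βt)) · p^f(1/β) as t→∞ (provided p^f(1/β)>0), i.e. the ratio of the two sides tends to 1. -/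
open MeasureTheory Filter Set
open scoped ENNReal NNReal Topology Classical

noncomputable section

/-- The reciprocal of the Radon–Nikodym weight. -/
def invWeight (β t y : ℝ) : ℝ := √(1 + β * t) * Real.exp (-(β * y ^ 2 / (2 * (1 + β * t))))

lemma invWeight_pos {β t : ℝ} (y : ℝ) (h : 0 < 1 + β * t) : 0 < invWeight β t y :=
  mul_pos (Real.sqrt_pos.2 h) (Real.exp_pos _)

lemma transDensity_brownian (t x y : ℝ) :
    transDensity (√(2 * Real.pi))⁻¹ (-(1 : ℝ) / 2) Real.exp t x y =
      (√(2 * Real.pi))⁻¹ / √t * Real.exp (-(x - y) ^ 2 / (2 * t)) := by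
  have h : (2 * (-(1 : ℝ) / 2) + 1) = 0 := by norm_num
  rw [transDensity, h, Real.rpow_zero, mul_one, mul_assoc, ← Real.exp_add]
  congr 2
  rcases eq_or_ne t 0 with rfl | ht
  · simp
  · field_simp; ring

lemma transDensity_time_change {β s t : ℝ} (hβ : 0 < β) (hs : 0 ≤ s) (hst : s < t) (x y : ℝ) :
    transDensity (√(2 * Real.pi))⁻¹ (-(1 : ℝ) / 2) Real.exp
        (t / (1 + β * t) - s / (1 + β * s)) (x / (1 + β * s)) (y / (1 + β * t)) *
        invWeight β t y =
      (1 + β * t) * transDensity (√(2 * Real.pi))⁻¹ (-(1 : ℝ) / 2) Real.exp (t - s) x y *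
        invWeight β s x := by
  have ha : 0 < 1 + β * s := by positivity
  have hb : 0 < 1 + β * t := by nlinarith
  have hd : 0 < t - s := by linarith
  have e1 : t / (1 + β * t) - s / (1 + β * s) = (t - s) / ((1 + β * t) * (1 + β * s)) := by
    rw [div_sub_div _ _ hb.ne' ha.ne']
    congr 1; ring
  have e2 : √((t - s) / ((1 + β * t) * (1 + β * s))) =
      √(t - s) / (√(1 + β * t) * √(1 + β * s)) := by
    rw [Real.sqrt_div hd.le, Real.sqrt_mul hb.le]
  have e3 : -(x / (1 + β * s) - y / (1 + β * t)) ^ 2 /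
        (2 * ((t - s) / ((1 + β * t) * (1 + β * s)))) + -(β * y ^ 2 / (2 * (1 + β * t))) =
      -(x - y) ^ 2 / (2 * (t - s)) + -(β * x ^ 2 / (2 * (1 + β * s))) := by
    have := ha.ne'; have := hb.ne'; have := hd.ne'
    field_simp
    ring
  have hE := congrArg Real.exp e3
  rw [Real.exp_add, Real.exp_add] at hE
  rw [transDensity_brownian, transDensity_brownian, e1, e2, invWeight, invWeight]
  have h1 := (Real.sqrt_pos.2 ha).ne'
  have h2 := (Real.sqrt_pos.2 hb).ne'
  have h3 := (Real.sqrt_pos.2 hd).ne'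
  have h4 : (√(2 * Real.pi)) ≠ 0 := by positivity
  have h5 : √(1 + β * t) * √(1 + β * t) = 1 + β * t := Real.mul_self_sqrt hb.le
  generalize Real.exp (-(x / (1 + β * s) - y / (1 + β * t)) ^ 2 /
        (2 * ((t - s) / ((1 + β * t) * (1 + β * s))))) = E1 at *
  generalize Real.exp (-(β * y ^ 2 / (2 * (1 + β * t)))) = E2 at *
  generalize Real.exp (-(x - y) ^ 2 / (2 * (t - s))) = E3 at *
  generalize Real.exp (-(β * x ^ 2 / (2 * (1 + β * s)))) = E4 at *
  calc _ = (√(1 + β * t) * √(1 + β * t)) * (√(2 * Real.pi))⁻¹ / √(t - s) * √(1 + β * s) *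
          (E1 * E2) := by field_simp
    _ = _ := by rw [hE, h5]; ring

lemma prod_transDensity_time_change {β : ℝ} (hβ : 0 < β) {n : ℕ} {t : Fin (n + 1) → ℝ}
    (ht : StrictMono t) (h0 : 0 < t 0) (v : Fin (n + 1) → ℝ) :
    (∏ i : Fin (n + 1), transDensity (√(2 * Real.pi))⁻¹ (-(1 : ℝ) / 2) Real.exp
        ((Fin.cons 0 (fun i => t i / (1 + β * t i)) : Fin (n + 2) → ℝ) i.succ -
          (Fin.cons 0 (fun i => t i / (1 + β * t i)) : Fin (n + 2) → ℝ) i.castSucc)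
        ((Fin.cons 0 v : Fin (n + 2) → ℝ) i.castSucc)
        ((Fin.cons 0 v : Fin (n + 2) → ℝ) i.succ)) *
        invWeight β (t (Fin.last n)) ((1 + β * t (Fin.last n)) * v (Fin.last n)) =
      (∏ i, (1 + β * t i)) *
        ∏ i : Fin (n + 1), transDensity (√(2 * Real.pi))⁻¹ (-(1 : ℝ) / 2) Real.exp
        ((Fin.cons 0 t : Fin (n + 2) → ℝ) i.succ - (Fin.cons 0 t : Fin (n + 2) → ℝ) i.castSucc)
        ((Fin.cons 0 (fun i => (1 + β * t i) * v i) : Fin (n + 2) → ℝ) i.castSucc)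
        ((Fin.cons 0 (fun i => (1 + β * t i) * v i) : Fin (n + 2) → ℝ) i.succ) := by
  have hpos : ∀ i, 0 < t i := fun i => h0.trans_le (ht.monotone (Fin.zero_le i))
  have hb : ∀ i, 0 < 1 + β * t i := fun i => by have := hpos i; positivity
  set T : Fin (n + 2) → ℝ := Fin.cons 0 t with hT
  set V : Fin (n + 2) → ℝ := Fin.cons 0 (fun i => (1 + β * t i) * v i) with hV
  have eT : (Fin.cons 0 (fun i => t i / (1 + β * t i)) : Fin (n + 2) → ℝ) =
      fun j => T j / (1 + β * T j) := by
    funext j; refine Fin.cases ?_ (fun j => ?_) j <;> simp [hT]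
  have eV : (Fin.cons 0 v : Fin (n + 2) → ℝ) = fun j => V j / (1 + β * T j) := by
    funext j; refine Fin.cases ?_ (fun j => ?_) j
    · simp [hV]
    · simp only [hV, hT, Fin.cons_succ]
      rw [mul_div_cancel_left₀ _ (hb j).ne']
  have hTm : StrictMono T := by
    rw [Fin.strictMono_iff_lt_succ]
    intro i
    refine Fin.cases ?_ (fun j => ?_) i
    · simpa [hT] using h0
    · rw [← Fin.succ_castSucc]; simpa [hT] using ht (Fin.castSucc_lt_succ (i := j))
  have hT0 : ∀ j, 0 ≤ T j := fun j => by
    have := hTm.monotone (Fin.zero_le j); simpa [hT] using this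
  have hWpos : ∀ j, 0 < invWeight β (T j) (V j) := fun j =>
    invWeight_pos _ (by have := hT0 j; positivity)
  have key : ∀ i : Fin (n + 1), _ := fun i =>
    transDensity_time_change hβ (hT0 i.castSucc) (hTm (Fin.castSucc_lt_succ (i := i)))
      (V i.castSucc) (V i.succ)
  have hprod := Finset.prod_congr rfl (fun i (_ : i ∈ Finset.univ) => key i)
  simp only [Finset.prod_mul_distrib] at hprod
  have h1 := Fin.prod_univ_succ (fun j => invWeight β (T j) (V j))
  have h2 := Fin.prod_univ_castSucc (fun j => invWeight β (T j) (V j))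
  have hW0 : invWeight β (T 0) (V 0) = 1 := by simp [hT, hV, invWeight]
  have hTl : T (Fin.last (n + 1)) = t (Fin.last n) := by simp [hT, ← Fin.succ_last]
  have hVl : V (Fin.last (n + 1)) = (1 + β * t (Fin.last n)) * v (Fin.last n) := by
    simp [hV, ← Fin.succ_last]
  rw [hW0, one_mul, h2, hTl, hVl] at h1
  rw [← h1] at hprod
  have hne : (∏ i : Fin (n + 1), invWeight β (T i.castSucc) (V i.castSucc)) ≠ 0 :=
    Finset.prod_ne_zero_iff.2 fun i _ => (hWpos _).ne'
  rw [eT, eV]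
  apply mul_left_cancel₀ hne
  have hTs : ∀ i : Fin (n + 1), T i.succ = t i := fun i => by simp [hT]
  simp only [hTs] at hprod ⊢
  linear_combination hprod

lemma measurable_invWeight (β t : ℝ) : Measurable (invWeight β t) := by
  unfold invWeight; fun_prop

/-- Finite dimensional laws of `s ↦ (1 + βs) X_{s/(1+βs)}`, reweighted at the final time, are those
of Brownian motion. -/
lemma map_time_change_withDensity {Ω : Type*} [MeasurableSpace Ω] {X : ℝ → Ω → ℝ} {P : Measure Ω}
    (hX : IsBrownianMotion X P 0) {β : ℝ} (hβ : 0 < β) {n : ℕ} {t : Fin (n + 1) → ℝ}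
    (ht : StrictMono t) (h0 : 0 < t 0) :
    Measure.map (fun ω i => (1 + β * t i) * X (t i / (1 + β * t i)) ω)
      (P.withDensity fun ω => ENNReal.ofReal (invWeight β (t (Fin.last n))
        ((1 + β * t (Fin.last n)) * X (t (Fin.last n) / (1 + β * t (Fin.last n))) ω))) =
      Measure.map (fun ω i => X (t i) ω) P := by
  have hpos : ∀ i, 0 < t i := fun i => h0.trans_le (ht.monotone (Fin.zero_le i))
  have hb : ∀ i, 0 < 1 + β * t i := fun i => by have := hpos i; positivity
  set φ : Fin (n + 1) → ℝ := fun i => t i / (1 + β * t i) with hφ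
  have hφm : StrictMono φ := by
    intro i j hij
    rw [hφ]
    simp only
    rw [div_lt_div_iff₀ (hb i) (hb j)]
    nlinarith [ht hij]
  have hφ0 : 0 < φ 0 := div_pos h0 (hb 0)
  have h1 := hX.fdd n φ hφm hφ0
  have h2 := hX.fdd n t ht h0
  have hm : ∀ s : Fin (n + 1) → ℝ, Measurable fun ω i => X (s i) ω := fun s =>
    measurable_pi_lambda _ fun i => hX.meas _
  have hprod : 0 < ∏ i, (1 + β * t i) := Finset.prod_pos fun i _ => hb i
  set L : (Fin (n + 1) → ℝ) → (Fin (n + 1) → ℝ) := fun v i => (1 + β * t i) * v i with hL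
  have hLm : Measurable L := by fun_prop
  have hvol : ENNReal.ofReal (∏ i, (1 + β * t i)) • Measure.map L volume =
      (volume : Measure (Fin (n + 1) → ℝ)) := by
    have := Real.smul_map_diagonal_volume_pi (D := fun i => 1 + β * t i)
      (by rw [Matrix.det_diagonal]; exact hprod.ne')
    rw [Matrix.det_diagonal, abs_of_pos hprod] at this
    convert this using 3
    funext v i
    simp [hL, Matrix.mulVec_diagonal]
  have hdm : ∀ s : Fin (n + 1) → ℝ, Measurable fun v : Fin (n + 1) → ℝ => ENNReal.ofReal
      (∏ i : Fin (n + 1), transDensity (√(2 * Real.pi))⁻¹ (-(1 : ℝ) / 2) Real.exp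
            ((Fin.cons 0 s : Fin (n + 2) → ℝ) i.succ -
              (Fin.cons 0 s : Fin (n + 2) → ℝ) i.castSucc)
            ((Fin.cons 0 v : Fin (n + 2) → ℝ) i.castSucc)
            ((Fin.cons 0 v : Fin (n + 2) → ℝ) i.succ)) := by
    intro s
    have hc : ∀ j : Fin (n + 2), Measurable fun v : Fin (n + 1) → ℝ =>
        (Fin.cons 0 v : Fin (n + 2) → ℝ) j := by
      intro j
      refine Fin.cases ?_ (fun j => ?_) j
      · simp
      · simpa using measurable_pi_apply j
    simp only [transDensity_brownian]
    refine ENNReal.measurable_ofReal.comp (Finset.measurable_prod _ fun i _ => ?_)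
    have := hc i.castSucc
    have := hc i.succ
    fun_prop
  have hwm : Measurable fun v : Fin (n + 1) → ℝ =>
      ENNReal.ofReal (invWeight β (t (Fin.last n)) (v (Fin.last n))) :=
    ((measurable_invWeight _ _).comp (measurable_pi_apply _)).ennreal_ofReal
  refine Measure.ext_of_lintegral _ fun g hg => ?_
  have hZm := hm φ
  refine (lintegral_map hg (hLm.comp hZm)).trans ?_
  refine (lintegral_withDensity_eq_lintegral_mul P (hwm.comp (hLm.comp hZm))
    (hg.comp (hLm.comp hZm))).trans ?_
  rw [h2, lintegral_withDensity_eq_lintegral_mul _ (hdm t) hg]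
  have e2 := lintegral_map (μ := P) (f := fun v => ENNReal.ofReal
    (invWeight β (t (Fin.last n)) (L v (Fin.last n))) * g (L v))
    ((hwm.comp hLm).mul (hg.comp hLm)) hZm
  rw [h1] at e2
  refine e2.symm.trans ((lintegral_withDensity_eq_lintegral_mul _ (hdm φ)
    ((hwm.comp hLm).mul (hg.comp hLm))).trans ?_)
  conv_rhs => rw [← hvol]
  rw [lintegral_smul_measure, lintegral_map ((hdm t).mul hg) hLm, smul_eq_mul,
    ← lintegral_const_mul' _ _ ENNReal.ofReal_ne_top]
  refine lintegral_congr fun v => ?_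
  simp only [Pi.mul_apply, Function.comp_apply]
  rw [← mul_assoc, ← mul_assoc, ← ENNReal.ofReal_mul' (invWeight_pos _ (hb _)).le,
    ← ENNReal.ofReal_mul hprod.le, prod_transDensity_time_change hβ ht h0 v]

/-- The law of `s ↦ (1 + βs) X_{s/(1+βs)}` on `(0, b]`, reweighted at time `b`, is that of `X`. -/
lemma map_path_time_change_withDensity {Ω : Type*} [MeasurableSpace Ω] {X : ℝ → Ω → ℝ}
    {P : Measure Ω} (hX : IsBrownianMotion X P 0) {β : ℝ} (hβ : 0 < β) {b : ℝ} (hb : 0 < b)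
    {σ : ℝ → ℝ} (hσ : ∀ s, σ s ∈ Ioc 0 b) :
    Measure.map (fun ω s => (1 + β * σ s) * X (σ s / (1 + β * σ s)) ω)
      (P.withDensity fun ω => ENNReal.ofReal (invWeight β b
        ((1 + β * b) * X (b / (1 + β * b)) ω))) =
      Measure.map (fun ω s => X (σ s) ω) P := by
  have := hX.isProb
  have hXm : Measurable fun ω s => X (σ s) ω := measurable_pi_lambda _ fun s => hX.meas _
  have hYm : Measurable fun ω s => (1 + β * σ s) * X (σ s / (1 + β * σ s)) ω :=
    measurable_pi_lambda _ fun s => (hX.meas _).const_mul _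
  refine IsProjectiveLimit.unique
    (P := fun I => Measure.map (fun ω (s : I) => X (σ s) ω) P) ?_ ?_
  · intro I
    rw [Measure.map_map (by fun_prop) hYm]
    set J : Finset ℝ := insert b (I.image σ) with hJ
    obtain ⟨n, hn⟩ : ∃ n, J.card = n + 1 :=
      Nat.exists_eq_succ_of_ne_zero (Finset.card_pos.2 ⟨b, Finset.mem_insert_self _ _⟩).ne'
    set t : Fin (n + 1) → ℝ := fun i => J.orderEmbOfFin hn i with ht
    have hJmem : ∀ x ∈ J, x ∈ Ioc 0 b := by
      intro x hx
      rw [hJ, Finset.mem_insert, Finset.mem_image] at hx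
      rcases hx with rfl | ⟨s, -, rfl⟩
      · exact ⟨hb, le_rfl⟩
      · exact hσ s
    have htm : StrictMono t := (J.orderEmbOfFin hn).strictMono
    have htJ : ∀ i, t i ∈ J := fun i => J.orderEmbOfFin_mem hn i
    have hsurj : ∀ x ∈ J, ∃ i, t i = x := by
      intro x hx
      have : x ∈ Set.range (J.orderEmbOfFin hn) := by
        rw [Finset.range_orderEmbOfFin]; exact hx
      exact this
    have hlast : t (Fin.last n) = b := by
      obtain ⟨i, hi⟩ := hsurj b (Finset.mem_insert_self _ _)
      exact le_antisymm (hJmem _ (htJ _)).2 (hi ▸ htm.monotone (Fin.le_last i))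
    have key := map_time_change_withDensity hX hβ htm (hJmem _ (htJ 0)).1
    rw [hlast] at key
    choose e he using fun s : I => hsurj (σ s)
      (Finset.mem_insert_of_mem (Finset.mem_image_of_mem σ s.2))
    have hg : Measurable fun (v : Fin (n + 1) → ℝ) (s : I) => v (e s) := by fun_prop
    have key' := congrArg (Measure.map fun (v : Fin (n + 1) → ℝ) (s : I) => v (e s)) key
    rw [Measure.map_map hg (measurable_pi_lambda _ fun s => (hX.meas _).const_mul _),
      Measure.map_map hg (measurable_pi_lambda _ fun s => hX.meas _)] at key'
    simp only [Function.comp_def, he] at key'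
    exact key'
  · intro I
    rw [Measure.map_map (by fun_prop) hXm]
    rfl

lemma exists_eq_iff_forall_exists_rat {x F : ℝ → ℝ} (hx : ContinuousOn x (Ici 0))
    (hF : ContinuousOn F (Ici 0)) (h0 : x 0 ≠ F 0) (c : ℝ) :
    (∃ s ∈ Ioc 0 c, x s = F s) ↔
      ∀ n : ℕ, ∃ q : ℚ, 0 < (q : ℝ) ∧ (q : ℝ) ≤ c ∧ |x q - F q| < 1 / ((n : ℝ) + 1) := by
  have hd : ContinuousOn (fun s => |x s - F s|) (Ici 0) := (hx.sub hF).abs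
  constructor
  · rintro ⟨s, ⟨hs0, hsc⟩, hs⟩ n
    have hn : (0 : ℝ) < 1 / ((n : ℝ) + 1) := by positivity
    have hcs : ∀ᶠ y in 𝓝 s, |x y - F y| < 1 / ((n : ℝ) + 1) :=
      (hd.continuousAt (Ici_mem_nhds hs0)).tendsto.eventually_lt_const
        (by rwa [hs, sub_self, abs_zero])
    obtain ⟨δ, hδ, hball⟩ := Metric.eventually_nhds_iff.1 hcs
    obtain ⟨q, hq1, hq2⟩ := exists_rat_btwn (max_lt hs0 (sub_lt_self s hδ))
    rw [max_lt_iff] at hq1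
    refine ⟨q, hq1.1, (hq2.le.trans hsc), hball ?_⟩
    rw [Real.dist_eq, abs_lt]
    constructor <;> linarith [hq1.2]
  · intro h
    obtain ⟨q, hq0, hqc, -⟩ := h 0
    obtain ⟨s, hs, hmin⟩ := isCompact_Icc.exists_isMinOn (s := Icc 0 c) ⟨q, hq0.le, hqc⟩
      (hd.mono Icc_subset_Ici_self)
    have hz : |x s - F s| ≤ 0 := by
      refine ge_of_tendsto' tendsto_one_div_add_atTop_nhds_zero_nat fun n => ?_
      obtain ⟨q, hq0, hqc, hq⟩ := h n
      exact (hmin ⟨hq0.le, hqc⟩).trans hq.le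
    have hs' : x s = F s := sub_eq_zero.1 (abs_nonpos_iff.1 hz)
    refine ⟨s, ⟨lt_of_le_of_ne hs.1 ?_, hs.2⟩, hs'⟩
    rintro rfl
    exact h0 hs'

lemma hitTime_le_iff {Ω : Type*} {X : ℝ → Ω → ℝ} {F : ℝ → ℝ} {ω : Ω}
    (hx : ContinuousOn (fun s => X s ω) (Ici 0)) (hF : ContinuousOn F (Ici 0))
    (h0 : X 0 ω ≠ F 0) {c : ℝ} (hc : 0 ≤ c) :
    hitTime X F ω ≤ ENNReal.ofReal c ↔ ∃ s ∈ Ioc 0 c, X s ω = F s := by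
  constructor
  · intro h
    by_contra! hno
    obtain ⟨d, hcd, hd⟩ : ∃ d, c < d ∧ ∀ s, 0 < s → X s ω = F s → d ≤ s := by
      by_cases hne : ∃ s ∈ Icc 0 (c + 1), X s ω = F s
      · have hK : IsCompact {s ∈ Icc 0 (c + 1) | X s ω = F s} := by
          have hcl : IsClosed (Icc 0 (c + 1) ∩ (fun s => X s ω - F s) ⁻¹' {0}) :=
            ((hx.sub hF).mono Icc_subset_Ici_self).preimage_isClosed_of_isClosed isClosed_Icc
              isClosed_singleton
          refine isCompact_Icc.of_isClosed_subset ?_ (sep_subset _ _)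
          convert hcl using 1
          ext s
          simp [sub_eq_zero]
        obtain ⟨d, hd⟩ := hK.exists_isLeast hne
        have hd0 : 0 < d := lt_of_le_of_ne hd.1.1.1 (by rintro rfl; exact h0 hd.1.2)
        refine ⟨d, not_le.1 fun hdc => hno d ⟨hd0, hdc⟩ hd.1.2, fun s hs hXs => ?_⟩
        by_cases hsc : s ≤ c + 1
        · exact hd.2 ⟨⟨hs.le, hsc⟩, hXs⟩
        · exact hd.1.1.2.trans (not_le.1 hsc).le
      · push Not at hne
        exact ⟨c + 1, by linarith, fun s hs hXs => not_lt.1 fun hsc =>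
          hne s ⟨hs.le, hsc.le⟩ hXs⟩
    have : ENNReal.ofReal d ≤ hitTime X F ω :=
      le_iInf₂ fun s hs => ENNReal.ofReal_le_ofReal (hd s hs.1 hs.2)
    have := (ENNReal.ofReal_le_ofReal_iff hc).1 (this.trans h)
    linarith
  · rintro ⟨s, ⟨hs0, hsc⟩, hs⟩
    exact (iInf₂_le s ⟨hs0, hs⟩).trans (ENNReal.ofReal_le_ofReal hsc)

lemma eq_of_hitTime_eq {Ω : Type*} {X : ℝ → Ω → ℝ} {F : ℝ → ℝ} {ω : Ω}
    (hx : ContinuousOn (fun s => X s ω) (Ici 0)) (hF : ContinuousOn F (Ici 0))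
    (h0 : X 0 ω ≠ F 0) {r : ℝ} (hr : 0 ≤ r) (h : hitTime X F ω = ENNReal.ofReal r) :
    X r ω = F r := by
  obtain ⟨s, ⟨hs0, hsr⟩, hs⟩ := (hitTime_le_iff hx hF h0 hr).1 h.le
  have : ENNReal.ofReal r ≤ ENNReal.ofReal s := h ▸ iInf₂_le s ⟨hs0, hs⟩
  rw [le_antisymm ((ENNReal.ofReal_le_ofReal_iff hs0.le).1 this) hsr]
  exact hs

lemma measurable_hitTime {Ω : Type*} [MeasurableSpace Ω] {X : ℝ → Ω → ℝ} {F : ℝ → ℝ}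
    (hXm : ∀ t, Measurable (X t)) (hx : ∀ ω, Continuous fun s => X s ω)
    (hF : ContinuousOn F (Ici 0)) (h0 : ∀ ω, X 0 ω ≠ F 0) : Measurable (hitTime X F) := by
  refine measurable_of_Iic fun a => ?_
  induction a with
  | top => simp
  | coe c =>
    have : hitTime X F ⁻¹' Iic (c : ℝ≥0∞) = ⋂ n : ℕ, ⋃ q : ℚ,
        {ω | 0 < (q : ℝ) ∧ (q : ℝ) ≤ c ∧ |X q ω - F q| < 1 / ((n : ℝ) + 1)} := by
      ext ω
      have h := hitTime_le_iff (hx ω).continuousOn hF (h0 ω) c.2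
      rw [NNReal.val_eq_coe, ENNReal.ofReal_coe_nnreal] at h
      simp only [mem_preimage, mem_Iic, mem_iInter, mem_iUnion]
      exact h.trans (exists_eq_iff_forall_exists_rat (hx ω).continuousOn hF (h0 ω) c)
    rw [this]
    refine MeasurableSet.iInter fun n => MeasurableSet.iUnion fun q => ?_
    refine (MeasurableSet.const _).inter ((MeasurableSet.const _).inter ?_)
    exact measurableSet_lt ((hXm q).sub_const _).norm measurable_const

lemma continuousOn_Sb_s9 {β : ℝ} (hβ : 0 < β) {f : ℝ → ℝ} (hf : ContinuousOn f (Ici 0)) :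
    ContinuousOn (Sb β f) (Ici 0) := by
  have hne : ∀ t ∈ Ici (0 : ℝ), 1 + β * t ≠ 0 := fun t ht => by
    have : 0 ≤ t := ht
    positivity
  refine ContinuousOn.mul (by fun_prop) (hf.comp (ContinuousOn.div (by fun_prop) (by fun_prop) hne)
    fun t ht => ?_)
  have h0 : 0 ≤ t := ht
  exact mem_Ici.2 (div_nonneg h0 (by positivity))

lemma strictMonoOn_time_change {β : ℝ} (hβ : 0 < β) :
    StrictMonoOn (fun t => t / (1 + β * t)) (Ici 0) := by
  intro s (hs : 0 ≤ s) t (ht : 0 ≤ t) hst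
  simp only
  rw [div_lt_div_iff₀ (by positivity) (by positivity)]
  nlinarith

lemma time_change_inverse {β u : ℝ} (hu : 0 < 1 - β * u) :
    1 + β * (u / (1 - β * u)) = (1 - β * u)⁻¹ ∧
      u / (1 - β * u) / (1 + β * (u / (1 - β * u))) = u := by
  have h : 1 + β * (u / (1 - β * u)) = (1 - β * u)⁻¹ := by
    have := hu.ne'
    field_simp; ring
  refine ⟨h, ?_⟩
  rw [h, div_inv_eq_mul, div_mul_cancel₀ _ hu.ne']

lemma one_sub_mul_time_change {β t : ℝ} (ht : 0 < 1 + β * t) :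
    1 - β * (t / (1 + β * t)) = (1 + β * t)⁻¹ := by
  have := ht.ne'
  field_simp; ring

lemma exists_time_change_eq_Sb_iff {β : ℝ} (hβ : 0 < β) {x f : ℝ → ℝ} {c : ℝ} (hc : 0 ≤ c) :
    (∃ s ∈ Ioc 0 c, (1 + β * s) * x (s / (1 + β * s)) = Sb β f s) ↔
      ∃ u ∈ Ioc 0 (c / (1 + β * c)), x u = f u := by
  have hcp : 0 < 1 + β * c := by positivity
  constructor
  · rintro ⟨s, ⟨hs, hsc⟩, h⟩
    have hp : 0 < 1 + β * s := by positivity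
    exact ⟨s / (1 + β * s), ⟨div_pos hs hp, (strictMonoOn_time_change hβ).monotoneOn hs.le hc hsc⟩,
      mul_left_cancel₀ hp.ne' h⟩
  · rintro ⟨u, ⟨hu, huc⟩, h⟩
    have hu1 : 0 < 1 - β * u := by
      have := one_sub_mul_time_change hcp
      have := inv_pos.2 hcp
      nlinarith
    obtain ⟨-, h2⟩ := time_change_inverse hu1
    have hs : 0 < u / (1 - β * u) := div_pos hu hu1
    refine ⟨u / (1 - β * u), ⟨hs, ?_⟩, ?_⟩
    · rw [← (strictMonoOn_time_change hβ).le_iff_le hs.le hc]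
      simpa only [h2] using huc
    · rw [Sb, h2, h]

lemma measure_hitTime_Sb_Ioc {Ω : Type*} [MeasurableSpace Ω] {X : ℝ → Ω → ℝ} {P : Measure Ω}
    (hX : IsBrownianMotion X P 0) (hXc : ∀ ω, Continuous fun s => X s ω) (hX0 : ∀ ω, X 0 ω = 0)
    {β : ℝ} (hβ : 0 < β) {f : ℝ → ℝ} (hf : ContinuousOn f (Ici 0)) (hne : f 0 ≠ 0)
    {a b : ℝ} (ha : 0 ≤ a) (hab : a < b) :
    P (hitTime X (Sb β f) ⁻¹' Ioc (ENNReal.ofReal a) (ENNReal.ofReal b)) =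
      ∫⁻ ω in hitTime X f ⁻¹' Ioc (ENNReal.ofReal (a / (1 + β * a)))
          (ENNReal.ofReal (b / (1 + β * b))),
        ENNReal.ofReal (invWeight β b ((1 + β * b) * X (b / (1 + β * b)) ω)) ∂P := by
  have hb : 0 < b := ha.trans_lt hab
  set σ : ℝ → ℝ := fun s => if s ∈ Ioc 0 b then s else b with hσ
  have hσm : ∀ s, σ s ∈ Ioc 0 b := by
    intro s
    by_cases h : s ∈ Ioc 0 b
    · simp only [hσ, if_pos h, h]
    · simp only [hσ, if_neg h]; exact ⟨hb, le_rfl⟩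
  set F := Sb β f with hFdef
  have hFc : ContinuousOn F (Ici 0) := continuousOn_Sb_s9 hβ hf
  have hF0 : F 0 ≠ 0 := by simpa [hFdef, Sb] using hne
  set E : ℝ → Set (ℝ → ℝ) := fun c => ⋂ n : ℕ, ⋃ q : ℚ,
    {v | 0 < (q : ℝ) ∧ (q : ℝ) ≤ c ∧ |v q - F q| < 1 / ((n : ℝ) + 1)} with hE
  have hEm : ∀ c, MeasurableSet (E c) := fun c => by
    refine MeasurableSet.iInter fun n => MeasurableSet.iUnion fun q => ?_
    refine (MeasurableSet.const _).inter ((MeasurableSet.const _).inter ?_)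
    exact measurableSet_lt ((measurable_pi_apply (q : ℝ)).sub_const _).norm measurable_const
  have hEmem : ∀ x : ℝ → ℝ, ContinuousOn x (Ici 0) → x 0 = 0 → ∀ c ≤ b,
      ((fun s => x (σ s)) ∈ E c ↔ ∃ s ∈ Ioc 0 c, x s = F s) := by
    intro x hx hx0 c hc
    rw [exists_eq_iff_forall_exists_rat hx hFc (by rw [hx0]; exact hF0.symm)]
    simp only [hE, mem_iInter, mem_iUnion]
    refine forall_congr' fun n => exists_congr fun q => and_congr_right fun h1 =>
      and_congr_right fun h2 => ?_
    simp only [hσ, if_pos (show (q : ℝ) ∈ Ioc 0 b from ⟨h1, h2.trans hc⟩)]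
  have hYc : ∀ ω, ContinuousOn (fun s => (1 + β * s) * X (s / (1 + β * s)) ω) (Ici 0) :=
    fun ω => continuousOn_Sb_s9 hβ (hXc ω).continuousOn
  have hXset : hitTime X F ⁻¹' Ioc (ENNReal.ofReal a) (ENNReal.ofReal b) =
      (fun ω s => X (σ s) ω) ⁻¹' (E b \ E a) := by
    ext ω
    have h0 : X 0 ω ≠ F 0 := by rw [hX0]; exact hF0.symm
    have := hEmem (fun s => X s ω) (hXc ω).continuousOn (hX0 ω)
    rw [mem_preimage, mem_preimage, Set.mem_sdiff, this b le_rfl, this a hab.le, mem_Ioc, ← not_le,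
      hitTime_le_iff (hXc ω).continuousOn hFc h0 ha,
      hitTime_le_iff (hXc ω).continuousOn hFc h0 hb.le, and_comm]
  have hYset : hitTime X f ⁻¹' Ioc (ENNReal.ofReal (a / (1 + β * a)))
        (ENNReal.ofReal (b / (1 + β * b))) =
      (fun ω s => (1 + β * σ s) * X (σ s / (1 + β * σ s)) ω) ⁻¹' (E b \ E a) := by
    ext ω
    have h0 : X 0 ω ≠ f 0 := by rw [hX0]; exact hne.symm
    have := hEmem (fun s => (1 + β * s) * X (s / (1 + β * s)) ω) (hYc ω) (by simp [hX0])
    rw [mem_preimage, mem_preimage, Set.mem_sdiff, this b le_rfl, this a hab.le, mem_Ioc, ← not_le,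
      hitTime_le_iff (hXc ω).continuousOn hf h0 (div_nonneg ha (by positivity)),
      hitTime_le_iff (hXc ω).continuousOn hf h0 (div_nonneg hb.le (by positivity)),
      exists_time_change_eq_Sb_iff (x := fun s => X s ω) hβ ha,
      exists_time_change_eq_Sb_iff (x := fun s => X s ω) hβ hb.le, and_comm]
  have hXm : Measurable fun ω s => X (σ s) ω := measurable_pi_lambda _ fun s => hX.meas _
  have hYm : Measurable fun ω s => (1 + β * σ s) * X (σ s / (1 + β * σ s)) ω :=
    measurable_pi_lambda _ fun s => (hX.meas _).const_mul _
  have hAm := (hEm b).diff (hEm a)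
  rw [hXset, hYset, ← Measure.map_apply hXm hAm, ← map_path_time_change_withDensity hX hβ hb hσm,
    Measure.map_apply hYm hAm, withDensity_apply _ (hYm hAm)]

lemma invWeight_le {β t b y : ℝ} (hβ : 0 < β) (ht : 0 ≤ t) (htb : t ≤ b) :
    invWeight β t y ≤ √(1 + β * b) := by
  have h1 : √(1 + β * t) ≤ √(1 + β * b) := Real.sqrt_le_sqrt (by nlinarith)
  have h2 : Real.exp (-(β * y ^ 2 / (2 * (1 + β * t)))) ≤ 1 := by
    rw [Real.exp_le_one_iff, neg_nonpos]; positivity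
  calc _ ≤ √(1 + β * t) * 1 := mul_le_mul_of_nonneg_left h2 (Real.sqrt_nonneg _)
    _ ≤ _ := by rwa [mul_one]

lemma measure_hitTime_Sb_Ioc_eq_lintegral {Ω : Type*} [MeasurableSpace Ω] {X : ℝ → Ω → ℝ}
    {P : Measure Ω}
    (hX : IsBrownianMotion X P 0) (hXc : ∀ ω, Continuous fun s => X s ω) (hX0 : ∀ ω, X 0 ω = 0)
    {β : ℝ} (hβ : 0 < β) {f : ℝ → ℝ} (hf : ContinuousOn f (Ici 0)) (hne : f 0 ≠ 0)
    {a b : ℝ} (ha : 0 ≤ a) (hab : a < b) :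
    P (hitTime X (Sb β f) ⁻¹' Ioc (ENNReal.ofReal a) (ENNReal.ofReal b)) =
      ∫⁻ ω in hitTime X f ⁻¹' Ioc (ENNReal.ofReal (a / (1 + β * a)))
          (ENNReal.ofReal (b / (1 + β * b))),
        ENNReal.ofReal (invWeight β
          ((hitTime X f ω).toReal / (1 - β * (hitTime X f ω).toReal))
          (f (hitTime X f ω).toReal / (1 - β * (hitTime X f ω).toReal))) ∂P := by
  have := hX.isProb
  have hb : 0 < b := ha.trans_lt hab
  have h0f : ∀ ω, X 0 ω ≠ f 0 := fun ω => by rw [hX0]; exact hne.symm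
  have hF0 : ∀ ω, X 0 ω ≠ Sb β f 0 := fun ω => by rw [hX0]; simpa [Sb] using hne.symm
  have hTm := measurable_hitTime hX.meas hXc hf h0f
  have hTFm := measurable_hitTime hX.meas hXc (continuousOn_Sb_s9 hβ hf) hF0
  set t : ℕ → ℕ → ℝ := fun n i => a + i * ((b - a) / (n + 1)) with ht
  have hδ : ∀ n : ℕ, 0 < (b - a) / (n + 1) := fun n => div_pos (by linarith) (by positivity)
  have htm : ∀ n, StrictMono (t n) := fun n => strictMono_nat_of_lt_succ fun i => by
    have := hδ n
    simp only [ht]; push_cast; linarith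
  have ht0 : ∀ n, t n 0 = a := fun n => by simp [ht]
  have htl : ∀ n, t n (n + 1) = b := fun n => by
    simp only [ht]; push_cast; field_simp; ring
  have htnn : ∀ n i, 0 ≤ t n i := fun n i =>
    ha.trans (ht0 n ▸ (htm n).monotone (Nat.zero_le i))
  set c : ℕ → ℕ → ℝ≥0∞ := fun n i => ENNReal.ofReal (t n i / (1 + β * t n i)) with hc
  have hcm : ∀ n, Monotone (c n) := fun n i j hij => ENNReal.ofReal_le_ofReal
    ((strictMonoOn_time_change hβ).monotoneOn (htnn n i) (htnn n j) ((htm n).monotone hij))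
  have hdm : ∀ n, Monotone fun i => ENNReal.ofReal (t n i) := fun n i j hij =>
    ENNReal.ofReal_le_ofReal ((htm n).monotone hij)
  set G : ℝ → Ω → ℝ≥0∞ := fun s ω =>
    ENNReal.ofReal (invWeight β s ((1 + β * s) * X (s / (1 + β * s)) ω)) with hG
  have hGm : ∀ s, Measurable (G s) := fun s =>
    ((measurable_invWeight _ _).comp ((hX.meas _).const_mul _)).ennreal_ofReal
  set Z : ℕ → Ω → ℝ≥0∞ := fun n ω => ∑ i ∈ Finset.Ico 0 (n + 1),
    (hitTime X f ⁻¹' Ioc (c n i) (c n (i + 1))).indicator (G (t n (i + 1))) ω with hZ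
  have hsum : ∀ n, P (hitTime X (Sb β f) ⁻¹' Ioc (ENNReal.ofReal a) (ENNReal.ofReal b)) =
      ∫⁻ ω, Z n ω ∂P := by
    intro n
    have hU := (hdm n).biUnion_Ico_Ioc_map_succ 0 (n + 1)
    simp only [ht0, htl] at hU
    rw [← hU, preimage_iUnion₂]
    have hfin := measure_biUnion_finset (μ := P) (s := Finset.Ico 0 (n + 1))
      (f := fun i => hitTime X (Sb β f) ⁻¹' Ioc (ENNReal.ofReal (t n i))
        (ENNReal.ofReal (t n (i + 1))))
      (fun i _ j _ hij => Disjoint.preimage _ ((hdm n).pairwise_disjoint_on_Ioc_succ hij))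
      (fun i _ => hTFm measurableSet_Ioc)
    simp only [Finset.mem_Ico] at hfin
    simp only [mem_Ico]
    rw [show (Order.succ : ℕ → ℕ) = fun i => i + 1 from rfl] at *
    rw [hfin, hZ, lintegral_finsetSum _ fun i _ => (hGm _).indicator (hTm measurableSet_Ioc)]
    refine Finset.sum_congr rfl fun i _ => ?_
    rw [lintegral_indicator (hTm measurableSet_Ioc),
      measure_hitTime_Sb_Ioc hX hXc hX0 hβ hf hne (htnn n i) (htm n (Nat.lt_succ_self i))]
  have hcU : ∀ n, ⋃ i ∈ Ico 0 (n + 1), Ioc (c n i) (c n (i + 1)) =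
      Ioc (ENNReal.ofReal (a / (1 + β * a))) (ENNReal.ofReal (b / (1 + β * b))) := by
    intro n
    have := (hcm n).biUnion_Ico_Ioc_map_succ 0 (n + 1)
    simp only [hc, ht0, htl] at this
    exact this
  set S := hitTime X f ⁻¹' Ioc (ENNReal.ofReal (a / (1 + β * a)))
          (ENNReal.ofReal (b / (1 + β * b))) with hS
  have hZout : ∀ ω ∉ S, ∀ n, Z n ω = 0 := by
    intro ω hω n
    refine Finset.sum_eq_zero fun i hi => indicator_of_notMem (fun h => hω ?_) _
    rw [hS, mem_preimage, ← hcU n]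
    exact mem_iUnion₂.2 ⟨i, by simpa using hi, h⟩
  have hZin : ∀ ω ∈ S, ∀ n : ℕ, ∃ s, 0 < 1 - β * (hitTime X f ω).toReal ∧ 0 ≤ s ∧ s ≤ b ∧
      dist s ((hitTime X f ω).toReal / (1 - β * (hitTime X f ω).toReal)) ≤ (b - a) / (n + 1) ∧
      Z n ω = G s ω := by
    intro ω hω n
    rw [hS, mem_preimage, ← hcU n] at hω
    obtain ⟨i, hi, hmem⟩ := mem_iUnion₂.1 hω
    have hT : hitTime X f ω ≠ ∞ := (hmem.2.trans_lt ENNReal.ofReal_lt_top).ne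
    set u := (hitTime X f ω).toReal with hu
    have hTu : hitTime X f ω = ENNReal.ofReal u := (ENNReal.ofReal_toReal hT).symm
    have hu0 : 0 ≤ u := ENNReal.toReal_nonneg
    have hp : ∀ j, 0 < 1 + β * t n j := fun j => by have := htnn n j; positivity
    have hu1 : u ≤ t n (i + 1) / (1 + β * t n (i + 1)) := by
      have := hmem.2
      rwa [hTu, ENNReal.ofReal_le_ofReal_iff (div_nonneg (htnn _ _) (hp _).le)] at this
    have hu2 : t n i / (1 + β * t n i) < u := by
      have := hmem.1
      rwa [hTu, ENNReal.ofReal_lt_ofReal_iff_of_nonneg (div_nonneg (htnn _ _) (hp _).le)] at this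
    have hu3 : 0 < 1 - β * u := by
      have := one_sub_mul_time_change (hp (i + 1))
      have := inv_pos.2 (hp (i + 1))
      nlinarith
    obtain ⟨-, h2⟩ := time_change_inverse hu3
    have hr0 : 0 ≤ u / (1 - β * u) := div_nonneg hu0 hu3.le
    have hr1 : u / (1 - β * u) ≤ t n (i + 1) := by
      rw [← (strictMonoOn_time_change hβ).le_iff_le hr0 (htnn _ _)]
      simpa only [h2] using hu1
    have hr2 : t n i < u / (1 - β * u) := by
      rw [← (strictMonoOn_time_change hβ).lt_iff_lt (htnn _ _) hr0]
      simpa only [h2] using hu2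
    have hstep : t n (i + 1) = t n i + (b - a) / (n + 1) := by
      simp only [ht]; push_cast; ring
    refine ⟨t n (i + 1), hu3, htnn _ _, ?_, ?_, ?_⟩
    · exact htl n ▸ (htm n).monotone (Nat.succ_le_of_lt hi.2)
    · rw [Real.dist_eq, abs_of_nonneg (by linarith)]; linarith
    · rw [hZ]
      simp only
      rw [Finset.sum_eq_single i]
      · exact indicator_of_mem (s := hitTime X f ⁻¹' Ioc (c n i) (c n (i + 1))) hmem _
      · intro j _ hji
        refine indicator_of_notMem (fun h => ?_) _
        exact disjoint_left.1 ((hcm n).pairwise_disjoint_on_Ioc_succ hji) h hmem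
      · intro h; exact absurd (by simpa using hi) h
  have hlim := tendsto_lintegral_of_dominated_convergence' (μ := P) (F := Z)
    (f := S.indicator fun ω => ENNReal.ofReal (invWeight β
          ((hitTime X f ω).toReal / (1 - β * (hitTime X f ω).toReal))
          (f (hitTime X f ω).toReal / (1 - β * (hitTime X f ω).toReal))))
    (fun _ => ENNReal.ofReal (√(1 + β * b)))
    (fun n => (Finset.measurable_fun_sum _ fun i _ =>
      (hGm _).indicator (hTm measurableSet_Ioc)).aemeasurable)
    (fun n => Eventually.of_forall fun ω => by
      by_cases hω : ω ∈ S
      · obtain ⟨s, -, hs0, hsb, -, hs⟩ := hZin ω hω n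
        simp only
        rw [hs]
        exact ENNReal.ofReal_le_ofReal (invWeight_le hβ hs0 hsb)
      · simp only
        rw [hZout ω hω]; exact zero_le)
    (by simp) (Eventually.of_forall fun ω => by
      by_cases hω : ω ∈ S
      · choose s hu hs0 hsb hdist hs using hZin ω hω
        rw [indicator_of_mem hω]
        simp only [hs]
        have hT : hitTime X f ω ≠ ∞ := (hω.2.trans_lt ENNReal.ofReal_lt_top).ne
        have hXu := eq_of_hitTime_eq (hXc ω).continuousOn hf (h0f ω) ENNReal.toReal_nonneg
          (ENNReal.ofReal_toReal hT).symm
        have hu0 : 0 ≤ (hitTime X f ω).toReal := ENNReal.toReal_nonneg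
        generalize (hitTime X f ω).toReal = u at *
        obtain ⟨h1, h2⟩ := time_change_inverse (hu 0)
        set r := u / (1 - β * u) with hr
        have hr0 : 0 ≤ r := div_nonneg hu0 (hu 0).le
        have hrp : 0 < 1 + β * r := by positivity
        have hsr : Tendsto s atTop (𝓝 r) := by
          rw [tendsto_iff_dist_tendsto_zero]
          refine squeeze_zero (fun _ => dist_nonneg) hdist ?_
          have := (tendsto_one_div_add_atTop_nhds_zero_nat (𝕜 := ℝ)).const_mul (b - a)
          simpa [div_eq_mul_inv] using this
        have hcont : ContinuousAt (fun s => G s ω) r := by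
          have hXat : ContinuousAt (fun s => X (s / (1 + β * s)) ω) r :=
            ContinuousAt.comp (g := fun s => X s ω) (hXc ω).continuousAt
              (ContinuousAt.div (by fun_prop) (by fun_prop) hrp.ne')
          refine ENNReal.continuous_ofReal.continuousAt.comp ?_
          unfold invWeight
          refine ContinuousAt.mul (by fun_prop) (Real.continuous_exp.continuousAt.comp ?_)
          have hnum : ContinuousAt
              (fun s => β * ((1 + β * s) * X (s / (1 + β * s)) ω) ^ 2) r :=
            ((ContinuousAt.mul (by fun_prop) hXat).pow 2).const_mul β
          exact (ContinuousAt.div hnum (by fun_prop) (by positivity)).neg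
        have hGr : G r ω = ENNReal.ofReal (invWeight β r (f u / (1 - β * u))) := by
          simp only [hG]
          rw [h2, hXu, h1, inv_mul_eq_div]
        rw [← hGr]
        exact hcont.tendsto.comp hsr
      · rw [indicator_of_notMem hω]
        simp only [hZout ω hω]
        exact tendsto_const_nhds)
  simp only [← hsum] at hlim
  rw [lintegral_indicator (hTm measurableSet_Ioc)] at hlim
  exact tendsto_nhds_unique tendsto_const_nhds hlim

lemma continuousOn_invWeight_comp {β : ℝ} {f : ℝ → ℝ} (hf : ContinuousOn f (Ici 0))
    {s : Set ℝ} (hs : ∀ u ∈ s, 0 ≤ u ∧ 0 < 1 - β * u) :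
    ContinuousOn (fun u => invWeight β (u / (1 - β * u)) (f u / (1 - β * u))) s := by
  have hne : ∀ u ∈ s, 1 - β * u ≠ 0 := fun u hu => (hs u hu).2.ne'
  have h1 : ContinuousOn (fun u => u / (1 - β * u)) s :=
    ContinuousOn.div (by fun_prop) (by fun_prop) hne
  have h2 : ContinuousOn (fun u => f u / (1 - β * u)) s :=
    ContinuousOn.div (hf.mono fun u hu => (hs u hu).1) (by fun_prop) hne
  unfold invWeight
  refine ContinuousOn.mul (by fun_prop) (Real.continuous_exp.comp_continuousOn ?_)
  refine (ContinuousOn.div (by fun_prop) (by fun_prop) fun u hu => ?_).neg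
  rw [(time_change_inverse (hs u hu).2).1]
  have := (hs u hu).2
  positivity

lemma preimage_ofReal_image {Ω : Type*} (T : Ω → ℝ≥0∞) {s : Set ℝ} (hs : s ⊆ Ioi 0) :
    T ⁻¹' (ENNReal.ofReal '' s) = (fun ω => (T ω).toReal) ⁻¹' s := by
  ext ω
  simp only [mem_preimage, mem_image]
  constructor
  · rintro ⟨r, hr, h⟩
    rw [← h, ENNReal.toReal_ofReal (hs hr).le]
    exact hr
  · intro h
    have h0 : 0 < (T ω).toReal := hs h
    exact ⟨_, h, ENNReal.ofReal_toReal (ENNReal.toReal_pos_iff.1 h0).2.ne⟩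

lemma ofReal_image_Ioc {a b : ℝ} (ha : 0 ≤ a) :
    ENNReal.ofReal '' Ioc a b = Ioc (ENNReal.ofReal a) (ENNReal.ofReal b) := by
  ext x
  constructor
  · rintro ⟨r, ⟨h1, h2⟩, rfl⟩
    exact ⟨(ENNReal.ofReal_lt_ofReal_iff_of_nonneg ha).2 h1, ENNReal.ofReal_le_ofReal h2⟩
  · rintro ⟨h1, h2⟩
    have hx : x ≠ ∞ := (h2.trans_lt ENNReal.ofReal_lt_top).ne
    refine ⟨x.toReal, ⟨(ENNReal.ofReal_lt_iff_lt_toReal ha hx).1 h1, ?_⟩, ENNReal.ofReal_toReal hx⟩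
    by_contra! hlt
    rcases le_total 0 b with hb | hb
    · exact absurd ((ENNReal.ofReal_lt_iff_lt_toReal hb hx).2 hlt) h2.not_gt
    · rw [ENNReal.ofReal_of_nonpos hb] at h2
      exact not_lt_bot (h1.trans_le h2)

/-- Integration of a function of a random time against its density. -/
lemma HasHitDensity.setLIntegral_comp {Ω : Type*} [MeasurableSpace Ω] {T : Ω → ℝ≥0∞}
    {P : Measure Ω} {p : ℝ → ℝ} (h : HasHitDensity T P p) (hT : Measurable T)
    (hpc : ContinuousOn p (Ioi 0)) {a b : ℝ} (ha : 0 < a) {w : ℝ → ℝ}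
    (hw : ContinuousOn w (Ioc a b)) :
    ∫⁻ ω in T ⁻¹' Ioc (ENNReal.ofReal a) (ENNReal.ofReal b), ENNReal.ofReal (w (T ω).toReal) ∂P =
      ∫⁻ u in Ioc a b, ENNReal.ofReal (p u) * ENNReal.ofReal (w u) := by
  have hsub : Ioc a b ⊆ Ioi 0 := fun x hx => ha.trans hx.1
  have hτ : Measurable fun ω => (T ω).toReal := hT.ennreal_toReal
  have hpm : AEMeasurable (fun u => ENNReal.ofReal (p u)) (volume.restrict (Ioc a b)) :=
    ((hpc.mono hsub).aemeasurable measurableSet_Ioc).ennreal_ofReal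
  have hwm : AEMeasurable (fun u => ENNReal.ofReal (w u)) (volume.restrict (Ioc a b)) :=
    (hw.aemeasurable measurableSet_Ioc).ennreal_ofReal
  have hlaw : (P.restrict ((fun ω => (T ω).toReal) ⁻¹' Ioc a b)).map (fun ω => (T ω).toReal) =
      (volume.restrict (Ioc a b)).withDensity fun u => ENNReal.ofReal (p u) := by
    ext s hs
    rw [Measure.map_apply hτ hs, Measure.restrict_apply (hτ hs), withDensity_apply _ hs,
      Measure.restrict_restrict hs, ← preimage_inter,
      ← h _ (hs.inter measurableSet_Ioc) (inter_subset_right.trans hsub),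
      preimage_ofReal_image T (inter_subset_right.trans hsub)]
  have hwm' := hwm.mono_ac (withDensity_absolutelyContinuous _ fun u => ENNReal.ofReal (p u))
  rw [← ofReal_image_Ioc ha.le, preimage_ofReal_image T hsub]
  have := lintegral_withDensity_eq_lintegral_mul₀' hpm hwm'
  simp only [Pi.mul_apply] at this
  rw [← this]
  rw [← hlaw] at hwm' ⊢
  rw [lintegral_map' hwm' hτ.aemeasurable]

lemma hitDensity_Sb_lintegral {Ω : Type*} [MeasurableSpace Ω] {X : ℝ → Ω → ℝ} {P : Measure Ω}
    (hX : IsBrownianMotion X P 0) (hXc : ∀ ω, Continuous fun s => X s ω) (hX0 : ∀ ω, X 0 ω = 0)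
    {β : ℝ} (hβ : 0 < β) {f : ℝ → ℝ} (hf : ContinuousOn f (Ici 0)) (hne : f 0 ≠ 0)
    {p pβ : ℝ → ℝ} (hp : HasHitDensity (hitTime X f) P p) (hpc : ContinuousOn p (Ioi 0))
    (hpβ : HasHitDensity (hitTime X (Sb β f)) P pβ) {a b : ℝ} (ha : 0 < a) (hab : a < b) :
    ∫⁻ t in Ioc a b, ENNReal.ofReal (pβ t) =
      ∫⁻ u in Ioc (a / (1 + β * a)) (b / (1 + β * b)), ENNReal.ofReal (p u) *
        ENNReal.ofReal (invWeight β (u / (1 - β * u)) (f u / (1 - β * u))) := by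
  have hb : 0 < 1 + β * b := by have := ha.trans hab; positivity
  rw [← hpβ _ measurableSet_Ioc fun x hx => ha.trans hx.1, ofReal_image_Ioc ha.le,
    measure_hitTime_Sb_Ioc_eq_lintegral hX hXc hX0 hβ hf hne ha.le hab]
  have hTm := measurable_hitTime hX.meas hXc hf fun ω => by rw [hX0]; exact hne.symm
  refine hp.setLIntegral_comp hTm hpc (div_pos ha (by positivity))
    (w := fun u => invWeight β (u / (1 - β * u)) (f u / (1 - β * u)))
    (continuousOn_invWeight_comp hf fun u hu => ⟨?_, ?_⟩)
  · exact (div_nonneg ha.le (by positivity)).trans hu.1.le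
  · have := one_sub_mul_time_change hb
    have := inv_pos.2 hb
    nlinarith [hu.2]

lemma setLIntegral_Ioc_ofReal {g : ℝ → ℝ} {a b : ℝ} (hab : a ≤ b) (hg : ContinuousOn g (Icc a b))
    (h0 : ∀ x ∈ Ioc a b, 0 ≤ g x) :
    ∫⁻ x in Ioc a b, ENNReal.ofReal (g x) = ENNReal.ofReal (∫ x in a..b, g x) := by
  rw [intervalIntegral.integral_of_le hab, ofReal_integral_eq_lintegral_ofReal]
  · exact (hg.integrableOn_Icc).mono_set Ioc_subset_Icc_self
  · exact (ae_restrict_iff' measurableSet_Ioc).2 (Eventually.of_forall h0)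

lemma hasDerivAt_integral_of_continuousOn {g : ℝ → ℝ} {U : Set ℝ} (hU : IsOpen U)
    (hUc : U.OrdConnected) (hg : ContinuousOn g U) {a b : ℝ} (ha : a ∈ U) (hb : b ∈ U) :
    HasDerivAt (fun y => ∫ x in a..y, g x) (g b) b :=
  intervalIntegral.integral_hasDerivAt_right
    (hg.mono (hUc.uIcc_subset ha hb)).intervalIntegrable
    (hg.stronglyMeasurableAtFilter hU b hb) (hg.continuousAt (hU.mem_nhds hb))

lemma hasDerivAt_time_change {β t : ℝ} (ht : 0 < 1 + β * t) :
    HasDerivAt (fun t => t / (1 + β * t)) (1 / (1 + β * t) ^ 2) t := by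
  have h := (hasDerivAt_id t).div (((hasDerivAt_id t).const_mul β).const_add 1) ht.ne'
  refine h.congr_deriv ?_
  simp only [id]
  ring_nf

/-- The two hitting densities are related by the time change and the change of measure. -/
lemma hitDensity_Sb_eq {Ω : Type*} [MeasurableSpace Ω] {X : ℝ → Ω → ℝ} {P : Measure Ω}
    (hX : IsBrownianMotion X P 0) (hXc : ∀ ω, Continuous fun s => X s ω) (hX0 : ∀ ω, X 0 ω = 0)
    {β : ℝ} (hβ : 0 < β) {f : ℝ → ℝ} (hf : ContinuousOn f (Ici 0)) (hne : f 0 ≠ 0)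
    {p pβ : ℝ → ℝ} (hp : HasHitDensity (hitTime X f) P p) (hpc : ContinuousOn p (Ioi 0))
    (hpβ : HasHitDensity (hitTime X (Sb β f)) P pβ) (hpβc : ContinuousOn pβ (Ioi 0))
    {t : ℝ} (ht : 0 < t) :
    max (pβ t) 0 = max (p (t / (1 + β * t))) 0 * invWeight β t (Sb β f t) *
      (1 / (1 + β * t) ^ 2) := by
  have hmono := (strictMonoOn_time_change hβ).monotoneOn
  set g : ℝ → ℝ := fun u => max (p u) 0 *
    invWeight β (u / (1 - β * u)) (f u / (1 - β * u)) with hg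
  set q : ℝ → ℝ := fun u => max (pβ u) 0 with hq
  have hβ' : ∀ {u : ℝ}, u ∈ Ioo 0 β⁻¹ → 0 < 1 - β * u := fun {u} hu => by
    have := mul_lt_mul_of_pos_left hu.2 hβ
    rw [mul_inv_cancel₀ hβ.ne'] at this
    linarith
  have hW : ContinuousOn (fun u => invWeight β (u / (1 - β * u)) (f u / (1 - β * u)))
      (Ioo 0 β⁻¹) := continuousOn_invWeight_comp hf fun u hu => ⟨hu.1.le, hβ' hu⟩
  have hgc : ContinuousOn g (Ioo 0 β⁻¹) :=
    ((hpc.mono fun u (hu : u ∈ Ioo 0 β⁻¹) => hu.1).sup continuousOn_const).mul hW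
  have hqc : ContinuousOn q (Ioi 0) := hpβc.sup continuousOn_const
  have hmem : ∀ {s : ℝ}, 0 < s → s / (1 + β * s) ∈ Ioo 0 β⁻¹ := fun {s} hs => by
    have hs' : 0 < 1 + β * s := by positivity
    refine ⟨div_pos hs hs', ?_⟩
    rw [div_lt_iff₀ hs', mul_add, inv_mul_cancel_left₀ hβ.ne', mul_one]
    have := inv_pos.2 hβ
    linarith
  have hWpos : ∀ u ∈ Ioo 0 β⁻¹, 0 ≤ invWeight β (u / (1 - β * u)) (f u / (1 - β * u)) :=
    fun u _ => mul_nonneg (Real.sqrt_nonneg _) (Real.exp_pos _).le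
  have hgpos : ∀ u ∈ Ioo 0 β⁻¹, 0 ≤ g u := fun u hu =>
    mul_nonneg (le_max_right _ _) (hWpos u hu)
  set a := t / 2 with ha
  have ha0 : 0 < a := by positivity
  have hat : a < t := by linarith
  have hint : ∀ b, a < b → ∫ x in a..b, q x =
      ∫ u in (a / (1 + β * a))..(b / (1 + β * b)), g u := by
    intro b hab
    have hb0 := ha0.trans hab
    have hsub : Icc (a / (1 + β * a)) (b / (1 + β * b)) ⊆ Ioo 0 β⁻¹ := fun u hu =>
      ⟨(hmem ha0).1.trans_le hu.1, hu.2.trans_lt (hmem hb0).2⟩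
    have hle := hmono ha0.le hb0.le hab.le
    have h := hitDensity_Sb_lintegral hX hXc hX0 hβ hf hne hp hpc hpβ ha0 hab
    have h1 : ∫⁻ t in Ioc a b, ENNReal.ofReal (pβ t) = ENNReal.ofReal (∫ x in a..b, q x) := by
      rw [← setLIntegral_Ioc_ofReal hab.le (hqc.mono fun x hx => ha0.trans_le hx.1)
        fun x _ => le_max_right _ _]
      simp [hq, ENNReal.ofReal_max]
    have h2 : ∫⁻ u in Ioc (a / (1 + β * a)) (b / (1 + β * b)), ENNReal.ofReal (p u) *
        ENNReal.ofReal (invWeight β (u / (1 - β * u)) (f u / (1 - β * u))) =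
        ENNReal.ofReal (∫ u in (a / (1 + β * a))..(b / (1 + β * b)), g u) := by
      rw [← setLIntegral_Ioc_ofReal hle (hgc.mono hsub)
        fun u hu => hgpos u (hsub (Ioc_subset_Icc_self hu))]
      refine setLIntegral_congr_fun measurableSet_Ioc fun u hu => ?_
      simp only [hg]
      rw [ENNReal.ofReal_mul (le_max_right _ _)]
      simp [ENNReal.ofReal_max]
    rw [h1, h2, ENNReal.ofReal_eq_ofReal_iff] at h
    · exact h
    · exact intervalIntegral.integral_nonneg hab.le fun x _ => le_max_right _ _
    · exact intervalIntegral.integral_nonneg hle fun u hu => hgpos u (hsub hu)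
  have htp : 0 < 1 + β * t := by positivity
  have hd1 := hasDerivAt_integral_of_continuousOn isOpen_Ioi ordConnected_Ioi hqc ha0 ht
  have hd2 := (hasDerivAt_integral_of_continuousOn isOpen_Ioo ordConnected_Ioo hgc (hmem ha0)
    (hmem ht)).comp t (hasDerivAt_time_change htp)
  have heq : (fun y => ∫ x in a..y, q x) =ᶠ[𝓝 t]
      (fun y => ∫ u in (a / (1 + β * a))..y, g u) ∘ fun t => t / (1 + β * t) := by
    filter_upwards [Ioi_mem_nhds hat] with b hb using hint b hb
  have hfin := hd1.unique (hd2.congr_of_eventuallyEq heq)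
  simp only [hq, hg] at hfin
  rw [hfin, one_sub_mul_time_change htp, div_inv_eq_mul, div_inv_eq_mul, div_mul_cancel₀ _ htp.ne',
    mul_comm (f _)]
  rfl

/-- Brownian motion has a version all of whose paths are continuous and start at the origin. -/
lemma IsBrownianMotion.exists_continuous_version {Ω : Type*} [MeasurableSpace Ω]
    {X : ℝ → Ω → ℝ} {P : Measure Ω} (hX : IsBrownianMotion X P 0) :
    ∃ Y : ℝ → Ω → ℝ, IsBrownianMotion Y P 0 ∧ (∀ ω, Continuous fun s => Y s ω) ∧
      (∀ ω, Y 0 ω = 0) ∧ ∀ᵐ ω ∂P, ∀ s, X s ω = Y s ω := by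
  have hae := hX.cont.and hX.init
  obtain ⟨N, hN, hNm, hN0⟩ := exists_measurable_superset_of_null (ae_iff.1 hae)
  have hgood : ∀ ω ∉ N, Continuous (fun s => X s ω) ∧ X 0 ω = 0 := fun ω hω => by
    by_contra h
    exact hω (hN h)
  set Y : ℝ → Ω → ℝ := fun s => Nᶜ.indicator (X s) with hY
  have hXY : ∀ᵐ ω ∂P, ∀ s, X s ω = Y s ω := by
    filter_upwards [measure_eq_zero_iff_ae_notMem.1 hN0] with ω hω s
    exact (indicator_of_mem (s := Nᶜ) hω (X s)).symm
  have hc : ∀ ω, Continuous fun s => Y s ω := fun ω => by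
    by_cases hω : ω ∈ N
    · simpa [hY, hω] using continuous_const
    · simpa [hY, hω] using (hgood ω hω).1
  have h0 : ∀ ω, Y 0 ω = 0 := fun ω => by
    by_cases hω : ω ∈ N
    · simp [hY, hω]
    · simpa [hY, hω] using (hgood ω hω).2
  refine ⟨Y, ⟨hX.isProb, fun s => (hX.meas s).indicator hNm.compl, Eventually.of_forall hc,
    Eventually.of_forall fun _ _ _ => mem_univ _, Eventually.of_forall h0, fun n t ht ht0 => ?_⟩,
    hc, h0, hXY⟩
  rw [← hX.fdd n t ht ht0]
  refine Measure.map_congr ?_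
  filter_upwards [hXY] with ω hω
  funext i
  exact (hω (t i)).symm

lemma HasHitDensity.congr {Ω : Type*} [MeasurableSpace Ω] {T S : Ω → ℝ≥0∞} {P : Measure Ω}
    {p : ℝ → ℝ} (h : HasHitDensity T P p) (hTS : T =ᵐ[P] S) : HasHitDensity S P p :=
  fun s hs hs0 => by
    rw [← h s hs hs0]
    refine measure_congr ?_
    filter_upwards [hTS] with ω hω
    exact congrArg (· ∈ ENNReal.ofReal '' s) hω.symm

/-- **Large time asymptotics of `p^{f^{(β)}}` for `β > 0`.**
`p^{f^{(β)}}(t) ~ (βt)^{-3/2} exp(-(β/2)(f^{(β)}(t))²/(1+βt)) p^f(1/β)` as `t → ∞`. -/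
theorem brownian_density_asymptotics
    {Ω : Type*} [MeasurableSpace Ω] (X : ℝ → Ω → ℝ) (P : Measure Ω)
    (hX : IsBrownianMotion X P 0)
    (f : ℝ → ℝ) (hf : ContDiffOn ℝ 1 f (Set.Ici 0)) (hne : f 0 ≠ 0)
    (β : ℝ) (hβ : 0 < β) (p pβ : ℝ → ℝ)
    (hp : HasHitDensity (hitTime X f) P p) (hpc : ContinuousOn p (Set.Ioi 0))
    (hpβ : HasHitDensity (hitTime X (Sb β f)) P pβ)
    (hpβc : ContinuousOn pβ (Set.Ioi 0))
    (hppos : 0 < p (1 / β)) :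
    Tendsto (fun t => pβ t /
        ((β * t) ^ (-(3 : ℝ) / 2) *
          Real.exp (-(β / 2) * (Sb β f t) ^ 2 / (1 + β * t)) * p (1 / β)))
      atTop (nhds 1) := by
  obtain ⟨Y, hY, hYc, hY0, hXY⟩ := IsBrownianMotion.exists_continuous_version hX
  have hhit : ∀ F, hitTime X F =ᵐ[P] hitTime Y F := fun F => by
    filter_upwards [hXY] with ω hω
    simp only [hitTime, hω]
  have hform : ∀ {t : ℝ}, 0 < t → _ := fun {t} ht =>
    hitDensity_Sb_eq hY hYc hY0 hβ hf.continuousOn hne (hp.congr (hhit f)) hpc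
      (hpβ.congr (hhit (Sb β f))) hpβc ht
  have hlin : Tendsto (fun t : ℝ => (β * t)⁻¹) atTop (𝓝 0) :=
    tendsto_inv_atTop_zero.comp (tendsto_id.const_mul_atTop hβ)
  have hratio : Tendsto (fun t : ℝ => 1 + (β * t)⁻¹) atTop (𝓝 1) := by
    simpa using hlin.const_add 1
  have hφ : Tendsto (fun t : ℝ => t / (1 + β * t)) atTop (𝓝 (1 / β)) := by
    have h1 : Tendsto (fun t : ℝ => β⁻¹ * (1 + (β * t)⁻¹)⁻¹) atTop (𝓝 (1 / β)) := by
      simpa using (hratio.inv₀ one_ne_zero).const_mul β⁻¹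
    refine h1.congr' ?_
    filter_upwards [eventually_gt_atTop 0] with t ht
    field_simp
    ring
  have hpφ : Tendsto (fun t : ℝ => p (t / (1 + β * t))) atTop (𝓝 (p (1 / β))) :=
    (hpc.continuousAt (Ioi_mem_nhds (one_div_pos.2 hβ))).tendsto.comp hφ
  have hlim : Tendsto (fun t : ℝ => (1 + (β * t)⁻¹) ^ (-(3 : ℝ) / 2) *
      (p (t / (1 + β * t)) / p (1 / β))) atTop (𝓝 1) := by
    have h1 := hratio.rpow_const (p := -(3 : ℝ) / 2) (Or.inl one_ne_zero)
    have h2 := hpφ.div_const (p (1 / β))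
    rw [div_self hppos.ne'] at h2
    simpa using h1.mul h2
  refine hlim.congr' ?_
  filter_upwards [eventually_gt_atTop 0, hpφ.eventually_const_lt hppos] with t ht hpt
  have hβt : 0 < β * t := by positivity
  have hb : 0 < 1 + β * t := by positivity
  have h := hform ht
  rw [max_eq_left hpt.le] at h
  have hpos : 0 < max (pβ t) 0 := by
    rw [h]
    have := invWeight_pos (Sb β f t) hb
    positivity
  rw [max_eq_left (by
    rcases lt_max_iff.1 hpos with h' | h'
    · exact h'.le
    · exact absurd h' (lt_irrefl _))] at h
  have hexp : -(β / 2) * Sb β f t ^ 2 / (1 + β * t) =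
      -(β * Sb β f t ^ 2 / (2 * (1 + β * t))) := by
    field_simp
  have hpow : √(1 + β * t) * (1 / (1 + β * t) ^ 2) = (1 + β * t) ^ (-(3 : ℝ) / 2) := by
    rw [Real.sqrt_eq_rpow, one_div ((1 + β * t) ^ 2), ← Real.rpow_natCast, ← Real.rpow_neg hb.le,
      ← Real.rpow_add hb]
    norm_num
  have hsplit : (1 + β * t) ^ (-(3 : ℝ) / 2) =
      (β * t) ^ (-(3 : ℝ) / 2) * (1 + (β * t)⁻¹) ^ (-(3 : ℝ) / 2) := by
    rw [← Real.mul_rpow hβt.le (by positivity)]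
    congr 1
    field_simp
    ring
  have hβtpow : (β * t) ^ (-(3 : ℝ) / 2) ≠ 0 := (Real.rpow_pos_of_pos hβt _).ne'
  rw [h, invWeight, hexp]
  have hE := (Real.exp_pos (-(β * Sb β f t ^ 2 / (2 * (1 + β * t))))).ne'
  generalize Real.exp (-(β * Sb β f t ^ 2 / (2 * (1 + β * t)))) = E at *
  rw [eq_div_iff (mul_ne_zero (mul_ne_zero hβtpow hE) hppos.ne')]
  calc _ = ((β * t) ^ (-(3 : ℝ) / 2) * (1 + (β * t)⁻¹) ^ (-(3 : ℝ) / 2)) * E *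
        p (t / (1 + β * t)) * (p (1 / β) / p (1 / β)) := by ring
    _ = _ := by rw [← hsplit, ← hpow, div_self hppos.ne']; ring

end
end
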